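/- arXiv:0909.0578 — 3 statements merged into one kernel-verified Lean document; each statement's English description precedes it below -/
import Mathlib

section
/- Let ζ₈ = exp(2πi/8), a = diag(ζ₈, ζ₈⁷), b = [[0, i], [i, 0]], c = (1/√2)·[[ζ₈⁷, ζ₈⁷], [ζ₈⁵, ζ₈]], and let Γ ⊂ SL₂(ℂ) be the binary tetrahedral group, the subgroup generated by a², b, c. Then in ℂ⟦t⟧: (1 − t⁶)(1 − t⁸)·Σₙ dim_ℂ((Symⁿ(ℂ²))^Γ)·tⁿ = 1 + t¹², where (Symⁿ(ℂ²))^Γ is the space of Γ-invariant vectors in the n-th symmetric power of the natural representation ℂ². -/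
open Matrix Complex PowerSeries CategoryTheory

/-- The `k`-th column image polynomial used to define the symmetric power:
the image of the basis vector `e₁^k e₂^(n-k)` of `Symⁿ(ℂ²)` under the endomorphism
induced by `g`, written as a polynomial in `X 0 ↔ e₁`, `X 1 ↔ e₂`. -/
noncomputable def symPoly2 (n : ℕ) (g : Matrix (Fin 2) (Fin 2) ℂ) (k : Fin (n + 1)) :
    MvPolynomial (Fin 2) ℂ :=
  (MvPolynomial.C (g 0 0) * MvPolynomial.X 0 + MvPolynomial.C (g 1 0) * MvPolynomial.X 1) ^ (k : ℕ) *
  (MvPolynomial.C (g 0 1) * MvPolynomial.X 0 + MvPolynomial.C (g 1 1) * MvPolynomial.X 1) ^ (n - (k : ℕ))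

/-- The matrix of the endomorphism `Symⁿ(g)` induced by `g` on the `n`-th symmetric power
of `ℂ²`, in the basis of monomials `e₁^i e₂^(n-i)`, `i = 0, …, n`. -/
noncomputable def symMatrix2 (n : ℕ) (g : Matrix (Fin 2) (Fin 2) ℂ) :
    Matrix (Fin (n + 1)) (Fin (n + 1)) ℂ :=
  Matrix.of fun i k =>
    MvPolynomial.coeff (Finsupp.single 0 (i : ℕ) + Finsupp.single 1 (n - (i : ℕ)))
      (symPoly2 n g k)

/-- The subspace of `Γ`-invariant vectors in the `n`-th symmetric power of `ℂ²`
(in the monomial-basis coordinates given by `symMatrix2`). -/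
noncomputable def symInvariants2 (Γ : Subgroup (SpecialLinearGroup (Fin 2) ℂ)) (n : ℕ) :
    Submodule ℂ (Fin (n + 1) → ℂ) where
  carrier := {v | ∀ g ∈ Γ, (symMatrix2 n (g : Matrix (Fin 2) (Fin 2) ℂ)).mulVec v = v}
  add_mem' := by
    intro a b ha hb g hg
    rw [Matrix.mulVec_add, ha g hg, hb g hg]
  zero_mem' := by
    intro g hg
    rw [Matrix.mulVec_zero]
  smul_mem' := by
    intro c x hx g hg
    rw [Matrix.mulVec_smul, hx g hg]

/-- The algebra endomorphism of `ℂ[X₀, X₁]` extending the action of `g` on linear forms. -/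
noncomputable def linearSubst (g : Matrix (Fin 2) (Fin 2) ℂ) :
    MvPolynomial (Fin 2) ℂ →ₐ[ℂ] MvPolynomial (Fin 2) ℂ :=
  MvPolynomial.aeval fun j =>
    MvPolynomial.C (g 0 j) * MvPolynomial.X 0 + MvPolynomial.C (g 1 j) * MvPolynomial.X 1

theorem linearSubst_C (g : Matrix (Fin 2) (Fin 2) ℂ) (z : ℂ) :
    linearSubst g (MvPolynomial.C z) = MvPolynomial.C z :=
  (linearSubst g).commutes z

theorem linearSubst_X (g : Matrix (Fin 2) (Fin 2) ℂ) (j : Fin 2) :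
    linearSubst g (MvPolynomial.X j) =
      MvPolynomial.C (g 0 j) * MvPolynomial.X 0 + MvPolynomial.C (g 1 j) * MvPolynomial.X 1 := by
  simp [linearSubst]

theorem linearSubst_X_pow_mul_X_pow (n : ℕ) (g : Matrix (Fin 2) (Fin 2) ℂ) (k : Fin (n + 1)) :
    linearSubst g (MvPolynomial.X 0 ^ (k : ℕ) * MvPolynomial.X 1 ^ (n - (k : ℕ))) =
      symPoly2 n g k := by
  simp [linearSubst_X, symPoly2]

theorem linearSubst_symPoly2 (n : ℕ) (g h : Matrix (Fin 2) (Fin 2) ℂ) (k : Fin (n + 1)) :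
    linearSubst g (symPoly2 n h k) = symPoly2 n (g * h) k := by
  simp only [symPoly2, map_mul, map_pow, map_add, linearSubst_C, linearSubst_X, Matrix.mul_apply,
    Fin.sum_univ_two]
  congr 2 <;> ring

theorem isHomogeneous_symPoly2 (n : ℕ) (g : Matrix (Fin 2) (Fin 2) ℂ) (k : Fin (n + 1)) :
    (symPoly2 n g k).IsHomogeneous n := by
  have hlin (z w : ℂ) : (MvPolynomial.C z * MvPolynomial.X 0 + MvPolynomial.C w * MvPolynomial.X 1 :
      MvPolynomial (Fin 2) ℂ).IsHomogeneous 1 :=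
    (MvPolynomial.isHomogeneous_C_mul_X z 0).add (MvPolynomial.isHomogeneous_C_mul_X w 1)
  have h := ((hlin (g 0 0) (g 1 0)).pow k).mul ((hlin (g 0 1) (g 1 1)).pow (n - k))
  rwa [one_mul, one_mul, Nat.add_sub_cancel' (Nat.le_of_lt_succ k.isLt)] at h

theorem single_add_single_eq_iff {n : ℕ} (i : ℕ) (d : Fin 2 →₀ ℕ) :
    Finsupp.single 0 i + Finsupp.single 1 (n - i) = d ↔ i = d 0 ∧ n - i = d 1 := by
  simp [Finsupp.ext_iff, Fin.forall_fin_two]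

theorem MvPolynomial.IsHomogeneous.eq_sum_fin_two {n : ℕ} {p : MvPolynomial (Fin 2) ℂ}
    (hp : p.IsHomogeneous n) :
    p = ∑ j : Fin (n + 1), MvPolynomial.C
      (p.coeff (Finsupp.single 0 (j : ℕ) + Finsupp.single 1 (n - (j : ℕ)))) *
        (MvPolynomial.X 0 ^ (j : ℕ) * MvPolynomial.X 1 ^ (n - (j : ℕ))) := by
  ext d
  have hmon (j : ℕ) : (MvPolynomial.X 0 ^ j * MvPolynomial.X 1 ^ (n - j) :
      MvPolynomial (Fin 2) ℂ) =
      MvPolynomial.monomial (Finsupp.single 0 j + Finsupp.single 1 (n - j)) 1 := by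
    simp [MvPolynomial.X_pow_eq_monomial, MvPolynomial.monomial_mul]
  simp only [hmon, MvPolynomial.coeff_sum, MvPolynomial.coeff_C_mul, MvPolynomial.coeff_monomial,
    mul_ite, mul_one, mul_zero]
  by_cases hd : d 0 + d 1 = n
  · have hsingle (j : Fin (n + 1)) :
        Finsupp.single 0 (j : ℕ) + Finsupp.single 1 (n - (j : ℕ)) = d ↔
          (⟨d 0, by omega⟩ : Fin (n + 1)) = j := by
      rw [single_add_single_eq_iff, Fin.ext_iff]
      dsimp only
      omega
    simp only [hsingle, Finset.sum_ite_eq, Finset.mem_univ, if_true]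
    congr 1
    exact ((single_add_single_eq_iff _ _).2 ⟨rfl, by omega⟩).symm
  · rw [hp.coeff_eq_zero, Finset.sum_eq_zero]
    · intro j _
      rw [if_neg]
      rw [single_add_single_eq_iff]
      have := j.isLt
      omega
    · simpa [Finsupp.degree_eq_sum] using hd

theorem symPoly2_eq_sum (n : ℕ) (g : Matrix (Fin 2) (Fin 2) ℂ) (k : Fin (n + 1)) :
    symPoly2 n g k = ∑ j : Fin (n + 1), MvPolynomial.C (symMatrix2 n g j k) *
      (MvPolynomial.X 0 ^ (j : ℕ) * MvPolynomial.X 1 ^ (n - (j : ℕ))) :=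
  (isHomogeneous_symPoly2 n g k).eq_sum_fin_two

theorem symMatrix2_mul (n : ℕ) (g h : Matrix (Fin 2) (Fin 2) ℂ) :
    symMatrix2 n (g * h) = symMatrix2 n g * symMatrix2 n h := by
  ext i k
  have key : symPoly2 n (g * h) k =
      ∑ j, MvPolynomial.C (symMatrix2 n h j k) * symPoly2 n g j := by
    rw [← linearSubst_symPoly2, symPoly2_eq_sum n h k, map_sum]
    simp only [map_mul (linearSubst g) (MvPolynomial.C _), linearSubst_C,
      linearSubst_X_pow_mul_X_pow]
  rw [Matrix.mul_apply]
  conv_lhs => rw [symMatrix2, Matrix.of_apply, key, MvPolynomial.coeff_sum]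
  refine Finset.sum_congr rfl fun j _ => ?_
  rw [MvPolynomial.coeff_C_mul, mul_comm]
  rfl

theorem symMatrix2_one (n : ℕ) : symMatrix2 n 1 = 1 := by
  ext i k
  have := i.isLt
  have := k.isLt
  have hmon : symPoly2 n 1 k = MvPolynomial.monomial
      (Finsupp.single 0 (k : ℕ) + Finsupp.single 1 (n - (k : ℕ))) 1 := by
    simp [symPoly2, MvPolynomial.X_pow_eq_monomial, MvPolynomial.monomial_mul]
  rw [symMatrix2, Matrix.of_apply, hmon, MvPolynomial.coeff_monomial, Matrix.one_apply]
  refine if_congr ?_ rfl rfl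
  rw [single_add_single_eq_iff, Fin.ext_iff]
  simp
  omega

/-- The `n`-th symmetric power as a multiplicative map on `2 × 2` matrices. -/
noncomputable def symHom2 (n : ℕ) :
    Matrix (Fin 2) (Fin 2) ℂ →* Matrix (Fin (n + 1)) (Fin (n + 1)) ℂ where
  toFun := symMatrix2 n
  map_one' := symMatrix2_one n
  map_mul' := symMatrix2_mul n

theorem symMatrix2_diag_of_upper (n : ℕ) (x s y : ℂ) (k : Fin (n + 1)) :
    symMatrix2 n !![x, s; 0, y] k k = x ^ (k : ℕ) * y ^ (n - (k : ℕ)) := by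
  have hk := k.isLt
  rw [symMatrix2, Matrix.of_apply, symPoly2]
  simp only [Matrix.of_apply, Matrix.cons_val', Matrix.cons_val_zero, Matrix.cons_val_one,
    Matrix.cons_val_fin_one, map_zero, zero_mul, add_zero, mul_pow, ← map_pow, mul_assoc,
    MvPolynomial.coeff_C_mul]
  congr 1
  rw [MvPolynomial.X_pow_eq_monomial, MvPolynomial.coeff_monomial_mul, one_mul, add_pow,
    MvPolynomial.coeff_sum, Finset.sum_eq_single 0]
  · rw [pow_zero, one_mul, Nat.choose_zero_right, Nat.cast_one, mul_one, Nat.sub_zero, mul_pow,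
      ← map_pow, MvPolynomial.coeff_C_mul, MvPolynomial.coeff_X_pow, if_pos rfl, mul_one]
  · intro m _ hm
    have : (MvPolynomial.C s * MvPolynomial.X 0) ^ m *
        (MvPolynomial.C y * MvPolynomial.X 1) ^ (n - (k : ℕ) - m) *
        (((n - (k : ℕ)).choose m : ℕ) : MvPolynomial (Fin 2) ℂ) =
      MvPolynomial.C (s ^ m * y ^ (n - (k : ℕ) - m) * ((n - (k : ℕ)).choose m : ℕ)) *
       MvPolynomial.monomial (Finsupp.single 0 m + Finsupp.single 1 (n - (k : ℕ) - m)) 1 := by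
      rw [← mul_one (1 : ℂ), ← MvPolynomial.monomial_mul, ← MvPolynomial.X_pow_eq_monomial,
        ← MvPolynomial.X_pow_eq_monomial]
      simp only [map_mul, map_pow, mul_pow, map_natCast]
      ring
    rw [this, MvPolynomial.coeff_C_mul, MvPolynomial.coeff_monomial, if_neg, mul_zero]
    rw [single_add_single_eq_iff]
    simp [hm]
  · simp

theorem exists_upper_triangular_conj (g : Matrix (Fin 2) (Fin 2) ℂ) :
    ∃ (p q : Matrix (Fin 2) (Fin 2) ℂ) (x s y : ℂ),
      q * p = 1 ∧ g = p * !![x, s; 0, y] * q := by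
  by_cases h : g 1 0 = 0
  · refine ⟨1, 1, g 0 0, g 0 1, g 1 1, by simp, ?_⟩
    rw [one_mul, mul_one, Matrix.eta_fin_two g, h]
    simp
  · obtain ⟨r, hr⟩ := IsAlgClosed.exists_eq_mul_self ((g 0 0 - g 1 1) ^ 2 + 4 * g 0 1 * g 1 0)
    set u := (g 0 0 - g 1 1 + r) / (2 * g 1 0) with hu
    refine ⟨!![u, 1; 1, 0], !![0, 1; 1, -u], g 1 0 * u + g 1 1, g 1 0, g 0 0 - g 1 0 * u, ?_, ?_⟩
    · ext i j
      fin_cases i <;> fin_cases j <;> simp [Matrix.mul_apply, Fin.sum_univ_two]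
    · have hquad : g 1 0 * u ^ 2 - (g 0 0 - g 1 1) * u - g 0 1 = 0 := by
        rw [hu]
        field_simp
        linear_combination -hr
      ext i j
      fin_cases i <;> fin_cases j <;> simp [Matrix.mul_apply, Fin.sum_univ_two] <;>
        first | ring1 | linear_combination hquad | linear_combination -hquad

theorem symMatrix2_trace_series (g : Matrix (Fin 2) (Fin 2) ℂ) :
    (1 - PowerSeries.C g.trace * PowerSeries.X + PowerSeries.C g.det * PowerSeries.X ^ 2) *
      PowerSeries.mk (fun n => (symMatrix2 n g).trace) = 1 := by
  obtain ⟨p, q, x, s, y, hqp, hg⟩ := exists_upper_triangular_conj g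
  have htr : g.trace = x + y := by
    rw [hg, Matrix.trace_mul_cycle, hqp, one_mul, Matrix.trace_fin_two_of]
  have hdet : g.det = x * y := by
    have : q.det * p.det = 1 := by rw [← Matrix.det_mul, hqp, Matrix.det_one]
    rw [hg, Matrix.det_mul, Matrix.det_mul, Matrix.det_fin_two_of]
    linear_combination x * y * this
  have hgeom (z : ℂ) : (1 - PowerSeries.C z * PowerSeries.X) * PowerSeries.mk (z ^ ·) = 1 := by
    ext n
    rw [sub_mul, one_mul, mul_assoc, map_sub, PowerSeries.coeff_C_mul]
    cases n with
    | zero => simp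
    | succ n => simp [PowerSeries.coeff_succ_X_mul, PowerSeries.coeff_one, pow_succ']
  have hmk : PowerSeries.mk (fun n => (symMatrix2 n g).trace) =
      PowerSeries.mk (x ^ ·) * PowerSeries.mk (y ^ ·) := by
    ext n
    rw [PowerSeries.coeff_mk, PowerSeries.coeff_mul, hg, symMatrix2_mul, symMatrix2_mul,
      Matrix.trace_mul_cycle, ← symMatrix2_mul, hqp, symMatrix2_one, one_mul,
      Finset.Nat.sum_antidiagonal_eq_sum_range_succ_mk, Finset.sum_range]
    simp [Matrix.trace, symMatrix2_diag_of_upper]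
  rw [hmk, htr, hdet, map_add, map_mul]
  linear_combination (1 - PowerSeries.C y * PowerSeries.X) * PowerSeries.mk (y ^ ·) * hgeom x
    + hgeom y

section TetrahedralRelations

variable {R : Type*} [Ring R] {x y z : R}

/-- The sum over the words `xⁱ yʲ zᵏ` with `i < 4`, `j < 2`, `k < 3`, which enumerate the binary
tetrahedral group. -/
def tetrahedralSum (x y z : R) : R :=
  (1 + x + x ^ 2 + x ^ 3) * (1 + y) * (1 + z + z ^ 2)

theorem mul_tetrahedralSum_left (hx : x ^ 4 = 1) :
    x * tetrahedralSum x y z = tetrahedralSum x y z := by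
  have h : x * (1 + x + x ^ 2 + x ^ 3) = 1 + x + x ^ 2 + x ^ 3 := by
    calc x * (1 + x + x ^ 2 + x ^ 3) = x + x ^ 2 + x ^ 3 + x ^ 4 := by noncomm_ring
      _ = 1 + x + x ^ 2 + x ^ 3 := by rw [hx]; abel
  rw [tetrahedralSum, ← mul_assoc, ← mul_assoc, h]

theorem mul_tetrahedralSum_middle (hx : x ^ 4 = 1) (hy : y ^ 2 = x ^ 2) (hyx : y * x = x ^ 3 * y) :
    y * tetrahedralSum x y z = tetrahedralSum x y z := by
  have h2 : y * x ^ 2 = x ^ 2 * y := by rw [← hy]; noncomm_ring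
  have h3 : y * x ^ 3 = x * y := by
    calc y * x ^ 3 = y * x ^ 2 * x := by noncomm_ring
      _ = x ^ 2 * (y * x) := by rw [h2, mul_assoc]
      _ = x ^ 4 * x * y := by rw [hyx]; noncomm_ring
      _ = x * y := by rw [hx, one_mul]
  have h : y * ((1 + x + x ^ 2 + x ^ 3) * (1 + y)) = (1 + x + x ^ 2 + x ^ 3) * (1 + y) := by
    calc y * ((1 + x + x ^ 2 + x ^ 3) * (1 + y))
        = (y + y * x + y * x ^ 2 + y * x ^ 3) * (1 + y) := by noncomm_ring
      _ = (1 + x + x ^ 2 + x ^ 3) * (y + y ^ 2) := by rw [hyx, h2, h3]; noncomm_ring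
      _ = (1 + x + x ^ 2 + x ^ 3) * y + (x ^ 2 + x ^ 3 + x ^ 4 + x ^ 4 * x) := by
        rw [hy]; noncomm_ring
      _ = (1 + x + x ^ 2 + x ^ 3) * (1 + y) := by rw [hx]; noncomm_ring
  rw [tetrahedralSum, ← mul_assoc, h]

theorem mul_tetrahedralSum_right (hx : x ^ 4 = 1) (hy : y ^ 2 = x ^ 2) (hyx : y * x = x ^ 3 * y)
    (hzx : z * x = x * y * z) (hzy : z * y = x * z) (hz : z ^ 3 = x ^ 2) :
    z * tetrahedralSum x y z = tetrahedralSum x y z := by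
  set s := (1 + x + x ^ 2 + x ^ 3) * (1 + y) with hs
  have hyx2 : y * x ^ 2 = x ^ 2 * y := by rw [← hy]; noncomm_ring
  have hxyx : x * y * x = y := by
    rw [mul_assoc, hyx, ← mul_assoc, ← pow_succ', hx, one_mul]
  have hzx2 : z * x ^ 2 = x ^ 2 * z := by rw [← hz]; noncomm_ring
  have hzx3 : z * x ^ 3 = x ^ 3 * y * z := by
    calc z * x ^ 3 = z * x ^ 2 * x := by noncomm_ring
      _ = x ^ 2 * (z * x) := by rw [hzx2, mul_assoc]
      _ = x ^ 3 * y * z := by rw [hzx]; noncomm_ring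
  have hzs : z * s = s * z := by
    have hyxz : x * y * (x * z) = y * z := by rw [← mul_assoc, hxyx]
    calc z * s = z + z * x + z * x ^ 2 + z * x ^ 3 + (z * y + z * x * y + z * x ^ 2 * y
          + z * x ^ 3 * y) := by rw [hs]; noncomm_ring
      _ = z + x * y * z + x ^ 2 * z + x ^ 3 * y * z + (z * y + x * y * (z * y) + x ^ 2 * (z * y)
          + x ^ 2 * (x * y * (z * y))) := by rw [hzx3, hzx2, hzx]; noncomm_ring
      _ = s * z := by rw [hzy, hyxz, hs]; noncomm_ring
  have hsx : s * x ^ 2 = s := by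
    calc s * x ^ 2 = (1 + x + x ^ 2 + x ^ 3) * (x ^ 2 + y * x ^ 2) := by rw [hs]; noncomm_ring
      _ = (x ^ 2 + x ^ 3 + x ^ 4 + x ^ 4 * x) * (1 + y) := by rw [hyx2]; noncomm_ring
      _ = s := by rw [hx, hs]; noncomm_ring
  calc z * tetrahedralSum x y z = z * s * (1 + z + z ^ 2) := (mul_assoc z s _).symm
    _ = s * z + s * z ^ 2 + s * z ^ 3 := by rw [hzs]; noncomm_ring
    _ = s * z + s * z ^ 2 + s := by rw [hz, hsx]
    _ = tetrahedralSum x y z := by rw [tetrahedralSum, ← hs]; noncomm_ring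

end TetrahedralRelations

theorem mulVec_tetrahedralSum {m : Type*} [Fintype m] [DecidableEq m] {x y z : Matrix m m ℂ}
    {v : m → ℂ} (hx : x *ᵥ v = v) (hy : y *ᵥ v = v) (hz : z *ᵥ v = v) :
    tetrahedralSum x y z *ᵥ v = (24 : ℂ) • v := by
  simp only [tetrahedralSum, ← Matrix.mulVec_mulVec, Matrix.add_mulVec, Matrix.one_mulVec, pow_succ,
    pow_zero, hx, hy, hz, Matrix.mulVec_add]
  module

/-- The representation of `SL₂(ℂ)` on the `n`-th symmetric power of `ℂ²`. -/
noncomputable def symRep2 (n : ℕ) :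
    SpecialLinearGroup (Fin 2) ℂ →* Matrix (Fin (n + 1)) (Fin (n + 1)) ℂ :=
  (symHom2 n).comp Matrix.SpecialLinearGroup.coeMonoidHom

theorem mem_symInvariants2_closure_iff {S : Set (SpecialLinearGroup (Fin 2) ℂ)} {n : ℕ}
    {v : Fin (n + 1) → ℂ} :
    v ∈ symInvariants2 (Subgroup.closure S) n ↔ ∀ g ∈ S, symRep2 n g *ᵥ v = v := by
  change (∀ g ∈ Subgroup.closure S, symRep2 n g *ᵥ v = v) ↔ _
  refine ⟨fun h g hg => h g (Subgroup.subset_closure hg), fun h g hg => ?_⟩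
  induction hg using Subgroup.closure_induction with
  | mem g hg => exact h g hg
  | one => rw [map_one, Matrix.one_mulVec]
  | mul g₁ g₂ _ _ h₁ h₂ => rw [map_mul, ← Matrix.mulVec_mulVec, h₂, h₁]
  | inv g _ hg =>
    conv_lhs => rw [← hg]
    rw [Matrix.mulVec_mulVec, ← map_mul, inv_mul_cancel, map_one, Matrix.one_mulVec]

theorem finrank_symInvariants2_closure {x y z : SpecialLinearGroup (Fin 2) ℂ}
    (hx : x ^ 4 = 1) (hy : y ^ 2 = x ^ 2) (hyx : y * x = x ^ 3 * y)
    (hzx : z * x = x * y * z) (hzy : z * y = x * z) (hz : z ^ 3 = x ^ 2) (n : ℕ) :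
    (24 : ℂ) * Module.finrank ℂ (symInvariants2 (Subgroup.closure {x, y, z}) n) =
      ∑ i : Fin 4, ∑ j : Fin 2, ∑ k : Fin 3,
        (symRep2 n (x ^ (i : ℕ) * y ^ (j : ℕ) * z ^ (k : ℕ))).trace := by
  set F := symRep2 n
  replace hx : F x ^ 4 = 1 := by rw [← map_pow, hx, map_one]
  replace hy : F y ^ 2 = F x ^ 2 := by rw [← map_pow, hy, map_pow]
  replace hyx : F y * F x = F x ^ 3 * F y := by rw [← map_mul, hyx, map_mul, map_pow]
  replace hzx : F z * F x = F x * F y * F z := by rw [← map_mul, hzx, map_mul, map_mul]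
  replace hzy : F z * F y = F x * F z := by rw [← map_mul, hzy, map_mul]
  replace hz : F z ^ 3 = F x ^ 2 := by rw [← map_pow, hz, map_pow]
  have hproj : LinearMap.IsProj (symInvariants2 (Subgroup.closure {x, y, z}) n)
      (Matrix.toLin' ((24 : ℂ)⁻¹ • tetrahedralSum (F x) (F y) (F z))) := by
    refine ⟨fun v => ?_, fun v hv => ?_⟩
    · rw [mem_symInvariants2_closure_iff, Matrix.toLin'_apply]
      rintro g (rfl | rfl | rfl)
      · rw [Matrix.mulVec_mulVec, Matrix.mul_smul, mul_tetrahedralSum_left hx]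
      · rw [Matrix.mulVec_mulVec, Matrix.mul_smul, mul_tetrahedralSum_middle hx hy hyx]
      · rw [Matrix.mulVec_mulVec, Matrix.mul_smul,
          mul_tetrahedralSum_right hx hy hyx hzx hzy hz]
    · rw [mem_symInvariants2_closure_iff] at hv
      rw [Matrix.toLin'_apply, Matrix.smul_mulVec, mulVec_tetrahedralSum (hv x (by simp))
        (hv y (by simp)) (hv z (by simp)), smul_smul, inv_mul_cancel₀ (by norm_num), one_smul]
  rw [← hproj.trace, Matrix.trace_toLin'_eq, Matrix.trace_smul, smul_eq_mul,
    mul_inv_cancel_left₀ (by norm_num)]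
  have hsum : tetrahedralSum (F x) (F y) (F z) = ∑ i : Fin 4, ∑ j : Fin 2, ∑ k : Fin 3,
      F (x ^ (i : ℕ) * y ^ (j : ℕ) * z ^ (k : ℕ)) := by
    simp only [map_mul, map_pow, ← Finset.mul_sum, ← Finset.sum_mul]
    simp [tetrahedralSum, Fin.sum_univ_succ, add_assoc]
  simp only [hsum, Matrix.trace_sum]

theorem mk_trace_symRep2 (g : SpecialLinearGroup (Fin 2) ℂ) :
    PowerSeries.mk (fun n => (symRep2 n g).trace) =
      (1 - PowerSeries.C (Matrix.SpecialLinearGroup.coeMonoidHom g).trace * PowerSeries.X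
        + PowerSeries.X ^ 2)⁻¹ := by
  rw [PowerSeries.eq_inv_iff_mul_eq_one (by simp), mul_comm]
  have h := symMatrix2_trace_series (g : Matrix (Fin 2) (Fin 2) ℂ)
  rwa [g.2, map_one, one_mul] at h

theorem exp_two_pi_I_div_eight :
    Complex.exp (2 * (Real.pi : ℂ) * Complex.I / 8) = (Real.sqrt 2 : ℂ) / 2 * (1 + Complex.I) := by
  have h : 2 * (Real.pi : ℂ) * Complex.I / 8 = ((Real.pi / 4 : ℝ) : ℂ) * Complex.I := by
    push_cast; ring
  rw [h, Complex.exp_mul_I, ← Complex.ofReal_cos, ← Complex.ofReal_sin, Real.cos_pi_div_four,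
    Real.sin_pi_div_four]
  push_cast; ring

/-- The traces of the words `xⁱ yʲ zᵏ` in the generators of the binary tetrahedral group. -/
def tetrahedralWordTrace : Fin 4 → Fin 2 → Fin 3 → ℂ :=
  ![![![2, 1, -1], ![0, 1, 1]],
    ![![0, 1, 1], ![0, 1, 1]],
    ![![-2, -1, 1], ![0, -1, -1]],
    ![![0, -1, -1], ![0, -1, -1]]]

theorem trace_tetrahedral_word (i : Fin 4) (j : Fin 2) (k : Fin 3) :
    ((!![Complex.I, 0; 0, -Complex.I] : Matrix (Fin 2) (Fin 2) ℂ) ^ (i : ℕ) *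
      !![0, Complex.I; Complex.I, 0] ^ (j : ℕ) *
      !![(1 - Complex.I) / 2, (1 - Complex.I) / 2;
        (-1 - Complex.I) / 2, (1 + Complex.I) / 2] ^ (k : ℕ)).trace =
      tetrahedralWordTrace i j k := by
  have hI := Complex.I_mul_I
  fin_cases i <;> fin_cases j <;> fin_cases k <;>
    simp [pow_succ, Matrix.trace_fin_two, tetrahedralWordTrace] <;> grind

/-- The Poincaré series of the invariants of the binary tetrahedral group `⟨a², b, c⟩ ⊆ SL₂(ℂ)`
(type `E₆`): `(1 − t⁶)(1 − t⁸)·Σₙ dim (Symⁿ(ℂ²))^Γ · tⁿ = 1 + t¹²` in `ℂ⟦t⟧`. -/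
theorem binary_tetrahedral_invariant_series
    (ζ : ℂ) (hζ : ζ = Complex.exp (2 * (Real.pi : ℂ) * Complex.I / 8))
    (a b c : Matrix (Fin 2) (Fin 2) ℂ)
    (hA : a = !![ζ, 0; 0, ζ ^ 7])
    (hB : b = !![0, Complex.I; Complex.I, 0])
    (hC : c = ((Real.sqrt 2 : ℂ))⁻¹ • !![ζ ^ 7, ζ ^ 7; ζ ^ 5, ζ])
    (Γ : Subgroup (SpecialLinearGroup (Fin 2) ℂ))
    (hΓ : Γ = Subgroup.closure {g : SpecialLinearGroup (Fin 2) ℂ |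
      (g : Matrix (Fin 2) (Fin 2) ℂ) = a ^ 2 ∨ (g : Matrix (Fin 2) (Fin 2) ℂ) = b ∨
        (g : Matrix (Fin 2) (Fin 2) ℂ) = c}) :
    (1 - PowerSeries.X ^ 6) * (1 - PowerSeries.X ^ 8) *
        PowerSeries.mk (fun n => (Module.finrank ℂ (symInvariants2 Γ n) : ℂ)) =
      1 + PowerSeries.X ^ 12 := by
  have hI := Complex.I_mul_I
  have hsq : ((Real.sqrt 2 : ℂ)) ^ 2 = 2 := by
    rw [← Complex.ofReal_pow, Real.sq_sqrt (by norm_num)]; norm_num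
  have hsqrt : (Real.sqrt 2 : ℂ) ≠ 0 := by
    intro h
    rw [h] at hsq
    norm_num at hsq
  rw [exp_two_pi_I_div_eight] at hζ
  have hζ2 : ζ ^ 2 = Complex.I := by
    rw [hζ]
    linear_combination (1 + Complex.I) ^ 2 / 4 * hsq + hI / 2
  have hζs : (Real.sqrt 2 : ℂ)⁻¹ * ζ = (1 + Complex.I) / 2 := by
    rw [hζ]
    field_simp
  have hζ5 : ζ ^ 5 = -ζ := by linear_combination ζ * (ζ ^ 2 + Complex.I) * hζ2 + ζ * hI
  have hζ7 : ζ ^ 7 = -Complex.I * ζ := by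
    linear_combination ζ ^ 2 * hζ5 - ζ * hζ2
  have ha : a ^ 2 = !![Complex.I, 0; 0, -Complex.I] := by
    rw [hA, pow_two, Matrix.mul_fin_two, hζ7]
    ext i j
    fin_cases i <;> fin_cases j <;> simp <;> grind
  have hc : c = !![(1 - Complex.I) / 2, (1 - Complex.I) / 2;
      (-1 - Complex.I) / 2, (1 + Complex.I) / 2] := by
    rw [hC, hζ5, hζ7]
    ext i j
    fin_cases i <;> fin_cases j <;> simp <;> grind
  let x : SpecialLinearGroup (Fin 2) ℂ :=
    ⟨!![Complex.I, 0; 0, -Complex.I], by simp⟩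
  let y : SpecialLinearGroup (Fin 2) ℂ :=
    ⟨!![0, Complex.I; Complex.I, 0], by simp⟩
  let z : SpecialLinearGroup (Fin 2) ℂ :=
    ⟨!![(1 - Complex.I) / 2, (1 - Complex.I) / 2;
      (-1 - Complex.I) / 2, (1 + Complex.I) / 2], by rw [Matrix.det_fin_two_of]; grind⟩
  have hinj := Matrix.SpecialLinearGroup.coeMonoidHom_injective (ι := Fin 2) (R := ℂ)
  have hxv : Matrix.SpecialLinearGroup.coeMonoidHom x = !![Complex.I, 0; 0, -Complex.I] := rfl
  have hyv : Matrix.SpecialLinearGroup.coeMonoidHom y = !![0, Complex.I; Complex.I, 0] := rfl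
  have hzv : Matrix.SpecialLinearGroup.coeMonoidHom z =
    !![(1 - Complex.I) / 2, (1 - Complex.I) / 2;
      (-1 - Complex.I) / 2, (1 + Complex.I) / 2] := rfl
  have hΓ' : Γ = Subgroup.closure {x, y, z} := by
    rw [hΓ, ha, hB, hc]
    congr 1
    ext g
    simp only [Set.mem_ofPred_eq, Set.mem_insert_iff, Set.mem_singleton_iff, ← hinj.eq_iff,
      hxv, hyv, hzv]
    rfl
  have hrank (n : ℕ) : (24 : ℂ) * Module.finrank ℂ (symInvariants2 Γ n) =
      ∑ i : Fin 4, ∑ j : Fin 2, ∑ k : Fin 3,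
        (symRep2 n (x ^ (i : ℕ) * y ^ (j : ℕ) * z ^ (k : ℕ))).trace := by
    rw [hΓ']
    refine finrank_symInvariants2_closure ?_ ?_ ?_ ?_ ?_ ?_ n <;> apply hinj <;>
      simp only [map_pow, map_mul, map_one, hxv, hyv, hzv] <;> ext i j <;>
      fin_cases i <;> fin_cases j <;> simp [pow_succ] <;> grind
  set H := PowerSeries.mk fun n => (Module.finrank ℂ (symInvariants2 Γ n) : ℂ) with hH
  let G (t : ℂ) : PowerSeries ℂ := (1 - PowerSeries.C t * PowerSeries.X + PowerSeries.X ^ 2)⁻¹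
  have hG (t : ℂ) : (1 - PowerSeries.C t * PowerSeries.X + PowerSeries.X ^ 2) * G t = 1 :=
    PowerSeries.mul_inv_cancel _ (by simp)
  have hword (i : Fin 4) (j : Fin 2) (k : Fin 3) :
      PowerSeries.mk (fun n => (symRep2 n (x ^ (i : ℕ) * y ^ (j : ℕ) * z ^ (k : ℕ))).trace) =
        G (tetrahedralWordTrace i j k) := by
    rw [mk_trace_symRep2, map_mul, map_mul, map_pow, map_pow, map_pow, hxv, hyv, hzv,
      trace_tetrahedral_word]
  have h24 : (24 : PowerSeries ℂ) = PowerSeries.C (24 : ℂ) := (map_ofNat PowerSeries.C 24).symm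
  have hsum : 24 * H = ∑ i : Fin 4, ∑ j : Fin 2, ∑ k : Fin 3,
      G (tetrahedralWordTrace i j k) := by
    simp only [← hword]
    ext n
    rw [h24, PowerSeries.coeff_C_mul, hH, PowerSeries.coeff_mk, hrank]
    simp only [map_sum, PowerSeries.coeff_mk]
  have hclasses : 24 * H = G 2 + G (-2) + 6 * G 0 + 8 * G 1 + 8 * G (-1) := by
    rw [hsum]
    simp [Fin.sum_univ_succ, tetrahedralWordTrace]
    ring
  have h2 := hG 2
  have h2' := hG (-2)
  have h0 := hG 0
  have h1 := hG 1
  have h1' := hG (-1)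
  have hC2 : PowerSeries.C (2 : ℂ) = 2 := map_ofNat PowerSeries.C 2
  simp only [map_neg, map_zero, map_one, hC2] at h2 h2' h0 h1 h1'
  refine mul_left_cancel₀ (a := (24 : PowerSeries ℂ)) (by simp [h24]) ?_
  generalize (PowerSeries.X : PowerSeries ℂ) = t at *
  linear_combination (1 - t ^ 6) * (1 - t ^ 8) * hclasses
    + (1 + t + t ^ 2 + t ^ 3 + t ^ 4 + t ^ 5)
      * (1 + t + t ^ 2 + t ^ 3 + t ^ 4 + t ^ 5 + t ^ 6 + t ^ 7) * h2
    + (1 - t + t ^ 2 - t ^ 3 + t ^ 4 - t ^ 5)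
      * (1 - t + t ^ 2 - t ^ 3 + t ^ 4 - t ^ 5 + t ^ 6 - t ^ 7) * h2'
    + 6 * (1 - t ^ 6) * (1 - t ^ 2) * (1 + t ^ 4) * h0
    + 8 * (1 - t ^ 8) * (1 - t ^ 3) * (1 + t) * h1
    + 8 * (1 - t ^ 8) * (1 + t ^ 3) * (1 - t) * h1'
end

section
/- Let Γ be a finite subgroup of SL₃(ℂ) with natural (inclusion) representation γ on ℂ³, and let γ₀, …, γ_l be the irreducible complex representations of Γ. Let A⁽¹⁾ ∈ M_{l+1}(ℕ) be the matrix whose (i,j) entry is the multiplicity of γᵢ in γⱼ ⊗ γ. Then A⁽¹⁾ commutes with its transpose, i.e., A⁽¹⁾ is a normal matrix. -/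
open Matrix Complex CategoryTheory

namespace Representation

variable {G V : Type*} [Group G] [AddCommGroup V] [Module ℂ V]

open scoped ComplexOrder in
/-- A matrix preserving a nondegenerate Hermitian form has an inverse whose trace is the complex
conjugate of its own trace; averaging provides such a form for a representation of a finite
group. -/
theorem character_inv_eq_conj [Finite G] [FiniteDimensional ℂ V]
    (ρ : Representation ℂ G V) (g : G) :
    ρ.character g⁻¹ = (starRingEnd ℂ) (ρ.character g) := by
  classical
  have := Fintype.ofFinite G
  let b := Module.finBasis ℂ V
  let M : G → Matrix _ _ ℂ := fun h => LinearMap.toMatrix b b (ρ h)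
  have hM (h k : G) : M (h * k) = M h * M k := by
    simp only [M, map_mul]
    exact LinearMap.toMatrix_mul b _ _
  have hM1 : M 1 = 1 := by
    simp only [M, map_one]
    exact LinearMap.toMatrix_one b
  have htr (h : G) : ρ.character h = (M h).trace := LinearMap.trace_eq_matrix_trace ℂ b _
  let P := ∑ h, (M h)ᴴ * M h
  have hP : P.PosDef := by
    have hsplit : P = 1 + ∑ h ∈ Finset.univ.erase 1, (M h)ᴴ * M h := by
      simp only [P]
      rw [← Finset.add_sum_erase _ _ (Finset.mem_univ (1 : G)), hM1]
      simp
    rw [hsplit]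
    exact Matrix.PosDef.one.add_posSemidef
      (Matrix.posSemidef_sum _ fun h _ => Matrix.posSemidef_conjTranspose_mul_self _)
  have hinv : (M g)ᴴ * P * M g = P := by
    simp only [P, Finset.mul_sum, Finset.sum_mul]
    refine Fintype.sum_equiv (Equiv.mulRight g) _ _ fun h => ?_
    simp only [Equiv.coe_mulRight, hM, conjTranspose_mul, Matrix.mul_assoc]
  have hcomm : (M g)ᴴ * P = P * M g⁻¹ := by
    calc (M g)ᴴ * P = (M g)ᴴ * P * (M g * M g⁻¹) := by rw [← hM, mul_inv_cancel, hM1, mul_one]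
      _ = P * M g⁻¹ := by rw [← Matrix.mul_assoc, hinv]
  have hdet : IsUnit P.det := (Matrix.isUnit_iff_isUnit_det _).mp hP.isUnit
  rw [htr, htr, starRingEnd_apply, ← trace_conjTranspose]
  calc (M g⁻¹).trace = (P⁻¹ * (P * M g⁻¹)).trace := by
        rw [Matrix.nonsing_inv_mul_cancel_left _ _ hdet]
    _ = (M g)ᴴ.trace := by
        rw [← hcomm, trace_mul_comm, Matrix.mul_nonsing_inv_cancel_right _ _ hdet]

theorem character_eq_add_of_isCompl [FiniteDimensional ℂ V] (ρ : Representation ℂ G V)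
    {σ τ : Subrepresentation ρ} (h : IsCompl σ.toSubmodule τ.toSubmodule) :
    ρ.character = σ.toRepresentation.character + τ.toRepresentation.character := by
  ext g
  let e := Submodule.prodEquivOfIsCompl _ _ h
  have he : ρ g = e.conj ((σ.toRepresentation g).prodMap (τ.toRepresentation g)) := by
    refine LinearMap.ext fun v => ?_
    obtain ⟨⟨x, y⟩, rfl⟩ := e.surjective v
    simp [LinearEquiv.conj_apply, e, Subrepresentation.toRepresentation]
  rw [character, he, LinearMap.trace_conj', LinearMap.trace_prodMap']
  rfl

end Representation

section

variable {G : Type} [Group G]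

theorem FDRep.simple_of_isIrreducible [Finite G] {V : Type} [AddCommGroup V] [Module ℂ V]
    [FiniteDimensional ℂ V] (ρ : Representation ℂ G V) [ρ.IsIrreducible] :
    Simple (FDRep.of ρ) := by
  have := Fintype.ofFinite G
  have hG : (Nat.card G : ℂ) ≠ 0 := NeZero.ne _
  have := invertibleOfNonzero hG
  rw [FDRep.simple_iff_char_is_norm_one]
  have h := Representation.card_inv_mul_sum_char_mul_char_eq_finrank ρ ρ
  rw [Representation.IsIrreducible.finrank_intertwiningMap_self, Nat.cast_one,
    inv_mul_eq_one₀ hG] at h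
  exact h.symm

variable {ι : Type*} {γ : ι → FDRep ℂ G}

theorem Representation.character_mem_span_of_complete [Finite G]
    (hcomplete : ∀ W : FDRep ℂ G, Simple W → ∃ i, Nonempty (W ≅ γ i))
    {V : Type} [AddCommGroup V] [Module ℂ V] [FiniteDimensional ℂ V]
    (ρ : Representation ℂ G V) :
    ρ.character ∈ Submodule.span ℂ (Set.range fun i => (γ i).character) := by
  induction hn : Module.finrank ℂ V using Nat.strong_induction_on generalizing V with
  | _ n ih =>
    subst hn
    by_cases hirr : ρ.IsIrreducible
    · obtain ⟨i, ⟨e⟩⟩ := hcomplete _ (FDRep.simple_of_isIrreducible ρ)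
      have he : ρ.character = (γ i).character := FDRep.char_iso e
      rw [he]
      exact Submodule.subset_span ⟨i, rfl⟩
    rcases subsingleton_or_nontrivial V with hV | hV
    · have hzero : ρ.character = 0 := by
        ext g
        simp [Representation.character, Subsingleton.elim (ρ g) 0]
      rw [hzero]
      exact zero_mem _
    obtain ⟨σ, hbot, htop⟩ : ∃ σ : Subrepresentation ρ, σ ≠ ⊥ ∧ σ ≠ ⊤ := by
      by_contra! hσ
      have : Nontrivial (Subrepresentation ρ) :=
        ⟨⊥, ⊤, fun h => bot_ne_top (α := Submodule ℂ V)
          (congrArg Subrepresentation.toSubmodule h)⟩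
      exact hirr ⟨fun σ => or_iff_not_imp_left.mpr (hσ σ)⟩
    obtain ⟨τ, hστ⟩ := exists_isCompl σ
    have hcompl : IsCompl σ.toSubmodule τ.toSubmodule :=
      IsCompl.of_eq (congrArg Subrepresentation.toSubmodule hστ.inf_eq_bot)
        (congrArg Subrepresentation.toSubmodule hστ.sup_eq_top)
    have hτ : τ ≠ ⊤ := fun h => hbot (eq_bot_of_isCompl_top (h ▸ hστ))
    have hlt (π : Subrepresentation ρ) (hπ : π ≠ ⊤) :
        Module.finrank ℂ π.toSubmodule < Module.finrank ℂ V :=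
      Submodule.finrank_lt fun h => hπ (Subrepresentation.toSubmodule_injective h)
    rw [ρ.character_eq_add_of_isCompl hcompl]
    exact add_mem (ih _ (hlt σ htop) _ rfl) (ih _ (hlt τ hτ) _ rfl)

variable [Fintype G]

/-- The matrix of multiplication by `f` with respect to the characters of `γ`. -/
noncomputable def FDRep.characterMulMatrix (γ : ι → FDRep ℂ G) (f : G → ℂ) : Matrix ι ι ℂ :=
  Matrix.of fun i j => (Fintype.card G : ℂ)⁻¹ *
    ∑ g, (γ j).character g * f g * (γ i).character g⁻¹

theorem FDRep.characterMulMatrix_transpose (f : G → ℂ) :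
    (characterMulMatrix γ f)ᵀ = characterMulMatrix γ fun g => f g⁻¹ := by
  ext i j
  simp only [characterMulMatrix, Matrix.transpose_apply, Matrix.of_apply]
  congr 1
  refine Fintype.sum_equiv (Equiv.inv G) _ _ fun g => ?_
  simp only [Equiv.inv_apply, inv_inv]
  ring

variable [Fintype ι]

theorem FDRep.eq_sum_of_mem_span_character (hsimple : ∀ i, Simple (γ i))
    (hdistinct : ∀ i j, i ≠ j → IsEmpty (γ i ≅ γ j)) {f : G → ℂ}
    (hf : f ∈ Submodule.span ℂ (Set.range fun i => (γ i).character)) :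
    f = ∑ k, ((Fintype.card G : ℂ)⁻¹ * ∑ g, f g * (γ k).character g⁻¹) • (γ k).character := by
  classical
  have hG : (Nat.card G : ℂ) ≠ 0 := NeZero.ne _
  have := invertibleOfNonzero hG
  induction hf using Submodule.span_induction with
  | mem x hx =>
    obtain ⟨i, rfl⟩ := hx
    have horth (k : ι) : (Fintype.card G : ℂ)⁻¹ *
        ∑ g, (γ i).character g * (γ k).character g⁻¹ = if i = k then 1 else 0 := by
      have hiff : Nonempty (γ i ≅ γ k) ↔ i = k :=
        ⟨fun h => by_contra fun hik => not_isEmpty_iff.mpr h (hdistinct i k hik),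
          fun h => h ▸ ⟨Iso.refl _⟩⟩
      rw [← Nat.card_eq_fintype_card, FDRep.char_orthonormal]
      simp only [hiff]
    simp [horth]
  | zero => simp
  | add x y _ _ hx hy =>
    conv_lhs => rw [hx, hy]
    simp only [Pi.add_apply, add_mul, Finset.sum_add_distrib, mul_add, add_smul]
  | smul a x _ hx =>
    conv_lhs => rw [hx]
    rw [Finset.smul_sum]
    refine Finset.sum_congr rfl fun k _ => ?_
    simp only [Pi.smul_apply, smul_eq_mul, smul_smul, mul_assoc, ← Finset.mul_sum]
    rw [mul_left_comm]

theorem FDRep.characterMulMatrix_mul (hsimple : ∀ i, Simple (γ i))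
    (hdistinct : ∀ i j, i ≠ j → IsEmpty (γ i ≅ γ j)) (f : G → ℂ) {f' : G → ℂ}
    (hf' : ∀ j, (γ j).character * f' ∈
      Submodule.span ℂ (Set.range fun i => (γ i).character)) :
    characterMulMatrix γ f * characterMulMatrix γ f' = characterMulMatrix γ (f * f') := by
  ext i j
  have h (g : G) := congrFun (eq_sum_of_mem_span_character hsimple hdistinct (hf' j)) g
  simp only [Pi.mul_apply, Finset.sum_apply, Pi.smul_apply, smul_eq_mul] at h
  simp only [Matrix.mul_apply, characterMulMatrix, Matrix.of_apply, Pi.mul_apply]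
  calc _ = ∑ k, ∑ g, (Fintype.card G : ℂ)⁻¹ * ((((Fintype.card G : ℂ)⁻¹ *
          ∑ g, (γ j).character g * f' g * (γ k).character g⁻¹) * (γ k).character g) *
          (f g * (γ i).character g⁻¹)) := by
        refine Finset.sum_congr rfl fun k _ => ?_
        rw [mul_assoc, Finset.sum_mul, Finset.mul_sum]
        exact Finset.sum_congr rfl fun g _ => by ring
    _ = _ := by
        rw [Finset.sum_comm, Finset.mul_sum]
        refine Finset.sum_congr rfl fun g _ => ?_
        rw [← Finset.mul_sum, ← Finset.sum_mul, ← h g]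
        ring

theorem FDRep.characterMulMatrix_mul_transpose_comm (hsimple : ∀ i, Simple (γ i))
    (hdistinct : ∀ i j, i ≠ j → IsEmpty (γ i ≅ γ j))
    (hcomplete : ∀ W : FDRep ℂ G, Simple W → ∃ i, Nonempty (W ≅ γ i))
    {V : Type} [AddCommGroup V] [Module ℂ V] [FiniteDimensional ℂ V]
    (ρ : Representation ℂ G V) :
    characterMulMatrix γ ρ.character * (characterMulMatrix γ ρ.character)ᵀ =
      (characterMulMatrix γ ρ.character)ᵀ * characterMulMatrix γ ρ.character := by
  have hmem {W : Type} [AddCommGroup W] [Module ℂ W] [FiniteDimensional ℂ W]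
      (σ : Representation ℂ G W) (j : ι) :
      (γ j).character * σ.character ∈
        Submodule.span ℂ (Set.range fun i => (γ i).character) := by
    have h := Representation.character_mem_span_of_complete hcomplete
      (Representation.tprod (γ j).ρ σ)
    rwa [Representation.char_tensor] at h
  have hdual : (fun g => ρ.character g⁻¹) = ρ.dual.character :=
    funext fun g => (ρ.char_dual g).symm
  rw [characterMulMatrix_transpose, hdual,
    characterMulMatrix_mul hsimple hdistinct _ (hmem ρ.dual),
    characterMulMatrix_mul hsimple hdistinct _ (hmem ρ), mul_comm]

end

/-- Let `Γ` be a finite subgroup of `SL₃(ℂ)` with natural representation `γ` (of character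
`g ↦ tr(g)`), and let `γ 0, …, γ l` be the irreducible complex representations of `Γ`
(pairwise non-isomorphic and complete).  The matrix `A⁽¹⁾` whose `(i, j)` entry is the
multiplicity of `γ i` in `γ j ⊗ γ` commutes with its transpose, i.e. `A⁽¹⁾` is normal. -/
theorem sl3_tensor_multiplicity_matrix_normal
    (Γ : Subgroup (SpecialLinearGroup (Fin 3) ℂ)) [Fintype Γ] (l : ℕ)
    (γ : Fin (l + 1) → FDRep ℂ Γ)
    (hsimple : ∀ i, Simple (γ i))
    (hdistinct : ∀ i j, i ≠ j → IsEmpty (γ i ≅ γ j))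
    (hcomplete : ∀ W : FDRep ℂ Γ, Simple W → ∃ i, Nonempty (W ≅ γ i))
    (A₁ : Matrix (Fin (l + 1)) (Fin (l + 1)) ℂ)
    (hA₁ : ∀ i j, A₁ i j = (Fintype.card Γ : ℂ)⁻¹ *
      ∑ g : Γ, (γ j).character g * Matrix.trace g.1.1 *
        (starRingEnd ℂ) ((γ i).character g)) :
    A₁ * A₁ᵀ = A₁ᵀ * A₁ := by
  let ρ : Representation ℂ Γ (Fin 3 → ℂ) :=
    (Matrix.toLinAlgEquiv' : Matrix (Fin 3) (Fin 3) ℂ ≃ₐ[ℂ] _).toMonoidHom.comp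
      (SpecialLinearGroup.coeMonoidHom.comp Γ.subtype)
  have hρ (g : Γ) : ρ.character g = Matrix.trace g.1.1 := Matrix.trace_toLin'_eq g.1.1
  have hA : A₁ = FDRep.characterMulMatrix γ ρ.character := by
    ext i j
    rw [hA₁]
    simp only [FDRep.characterMulMatrix, Matrix.of_apply, hρ]
    congr 1
    refine Finset.sum_congr rfl fun g _ => ?_
    congr 1
    exact (Representation.character_inv_eq_conj (γ i).ρ g).symm
  rw [hA]
  exact FDRep.characterMulMatrix_mul_transpose_comm hsimple hdistinct hcomplete ρ
end

section
/- Let ζ₅ = exp(2πi/5), S = diag(1, ζ₅⁴, ζ₅), U = [[−1,0,0],[0,0,−1],[0,−1,0]], T = (1/√5)·[[1,1,1],[2, ζ₅²+ζ₅³, ζ₅+ζ₅⁴],[2, ζ₅+ζ₅⁴, ζ₅²+ζ₅³]], and let Γ ⊂ SL₃(ℂ) be the subgroup generated by S, U, T (the exceptional subgroup of type H, isomorphic to the alternating group A₅). Then in ℂ⟦t⟧: (t−1)³·(t²+t+1)·(t⁴+t³+t²+t+1)·(t+1)²·Σₘ dim_ℂ((Symᵐ(ℂ³))^Γ)·tᵐ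 = −t⁸ − t⁷ + t⁵ + t⁴ + t³ − t − 1. -/
open Matrix Complex PowerSeries CategoryTheory

/-- Index of the monomial basis `e₁^a e₂^b e₃^(m-a-b)` (with `a + b ≤ m`) of the `m`-th
symmetric power `Symᵐ(ℂ³)`. -/
abbrev SymIdx3 (m : ℕ) : Type :=
  {p : Fin (m + 1) × Fin (m + 1) // (p.1 : ℕ) + (p.2 : ℕ) ≤ m}

/-- The image of the basis vector `e_j` of `ℂ³` under `g`, as a linear polynomial in
`X 0 ↔ e₁`, `X 1 ↔ e₂`, `X 2 ↔ e₃`. -/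
noncomputable def symCol3 (g : Matrix (Fin 3) (Fin 3) ℂ) (j : Fin 3) :
    MvPolynomial (Fin 3) ℂ :=
  ∑ i : Fin 3, MvPolynomial.C (g i j) * MvPolynomial.X i

/-- The image of the basis vector `e₁^a e₂^b e₃^(m-a-b)` of `Symᵐ(ℂ³)` under the
endomorphism induced by `g`, written as a polynomial. -/
noncomputable def symPoly3 (m : ℕ) (g : Matrix (Fin 3) (Fin 3) ℂ) (k : SymIdx3 m) :
    MvPolynomial (Fin 3) ℂ :=
  symCol3 g 0 ^ (k.1.1 : ℕ) * symCol3 g 1 ^ (k.1.2 : ℕ) *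
    symCol3 g 2 ^ (m - (k.1.1 : ℕ) - (k.1.2 : ℕ))

/-- The monomial exponent vector attached to a basis index of `Symᵐ(ℂ³)`. -/
noncomputable def symMono3 (m : ℕ) (p : SymIdx3 m) : Fin 3 →₀ ℕ :=
  Finsupp.single 0 (p.1.1 : ℕ) + Finsupp.single 1 (p.1.2 : ℕ) +
    Finsupp.single 2 (m - (p.1.1 : ℕ) - (p.1.2 : ℕ))

/-- The matrix of the endomorphism `Symᵐ(g)` induced by `g` on the `m`-th symmetric power
of `ℂ³`, in the basis of monomials `e₁^a e₂^b e₃^(m-a-b)`. -/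
noncomputable def symMatrix3 (m : ℕ) (g : Matrix (Fin 3) (Fin 3) ℂ) :
    Matrix (SymIdx3 m) (SymIdx3 m) ℂ :=
  Matrix.of fun i k => MvPolynomial.coeff (symMono3 m i) (symPoly3 m g k)

/-- The subspace of `Γ`-invariant vectors in the `m`-th symmetric power of `ℂ³`
(in the monomial-basis coordinates given by `symMatrix3`). -/
noncomputable def symInvariants3 (Γ : Subgroup (SpecialLinearGroup (Fin 3) ℂ)) (m : ℕ) :
    Submodule ℂ (SymIdx3 m → ℂ) where
  carrier := {v | ∀ g ∈ Γ, (symMatrix3 m (g : Matrix (Fin 3) (Fin 3) ℂ)).mulVec v = v}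
  add_mem' := by
    intro a b ha hb g hg
    rw [Matrix.mulVec_add, ha g hg, hb g hg]
  zero_mem' := by
    intro g hg
    rw [Matrix.mulVec_zero]
  smul_mem' := by
    intro c x hx g hg
    rw [Matrix.mulVec_smul, hx g hg]

open MvPolynomial in
lemma symPoly3_eq_aeval (m : ℕ) (g : Matrix (Fin 3) (Fin 3) ℂ) (k : SymIdx3 m) :
    symPoly3 m g k = MvPolynomial.aeval (symCol3 g) (monomial (symMono3 m k) (1 : ℂ)) := by
  simp only [symPoly3, symMono3, aeval_monomial, map_one, one_mul]
  rw [Finsupp.prod_fintype _ _ (by simp)]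
  simp [Fin.prod_univ_three]

lemma aeval_symCol3_symCol3 (g h : Matrix (Fin 3) (Fin 3) ℂ) (j : Fin 3) :
    MvPolynomial.aeval (symCol3 g) (symCol3 h j) = symCol3 (g * h) j := by
  simp only [symCol3, map_mul, MvPolynomial.aeval_C, MvPolynomial.aeval_X,
    MvPolynomial.algebraMap_eq, Matrix.mul_apply, Fin.sum_univ_three, map_add]
  ring

lemma aeval_symCol3_comp (g h : Matrix (Fin 3) (Fin 3) ℂ) (p : MvPolynomial (Fin 3) ℂ) :
    MvPolynomial.aeval (symCol3 g) (MvPolynomial.aeval (symCol3 h) p) =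
      MvPolynomial.aeval (symCol3 (g * h)) p := by
  have h' : (MvPolynomial.aeval (symCol3 g)).comp (MvPolynomial.aeval (symCol3 h)) =
      MvPolynomial.aeval (symCol3 (g * h)) :=
    MvPolynomial.algHom_ext fun j => by
      rw [AlgHom.comp_apply, MvPolynomial.aeval_X, MvPolynomial.aeval_X, aeval_symCol3_symCol3]
  exact DFunLike.congr_fun h' p

lemma symMono3_injective (m : ℕ) : Function.Injective (symMono3 m) := by
  rintro ⟨⟨a, b⟩, h⟩ ⟨⟨a', b'⟩, h'⟩ e
  have h0 := DFunLike.congr_fun e 0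
  have h1 := DFunLike.congr_fun e 1
  simp [symMono3] at h0 h1
  simp [Fin.ext_iff, h0, h1]

lemma exists_symMono3_eq {m : ℕ} {d : Fin 3 →₀ ℕ} (hd : d.degree = m) :
    ∃ i, symMono3 m i = d := by
  have hs : d 0 + d 1 + d 2 = m := by
    rw [← hd, Finsupp.degree_eq_sum, Fin.sum_univ_three]
  refine ⟨⟨(⟨d 0, by omega⟩, ⟨d 1, by omega⟩), by simp only; omega⟩, ?_⟩
  ext j
  fin_cases j <;> simp [symMono3]
  omega

lemma symPoly3_isHomogeneous (m : ℕ) (g : Matrix (Fin 3) (Fin 3) ℂ) (k : SymIdx3 m) :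
    (symPoly3 m g k).IsHomogeneous m := by
  have hc : ∀ j, (symCol3 g j).IsHomogeneous 1 := fun j =>
    MvPolynomial.IsHomogeneous.sum _ _ _ fun i _ => by
      simpa using (MvPolynomial.isHomogeneous_C (Fin 3) (g i j)).mul
        (MvPolynomial.isHomogeneous_X ℂ i)
  have h := (((hc 0).pow (k.1.1 : ℕ)).mul ((hc 1).pow (k.1.2 : ℕ))).mul
    ((hc 2).pow (m - (k.1.1 : ℕ) - (k.1.2 : ℕ)))
  have hk : m = 1 * (k.1.1 : ℕ) + 1 * (k.1.2 : ℕ) + 1 * (m - (k.1.1 : ℕ) - (k.1.2 : ℕ)) := by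
    have := k.2
    omega
  rw [← hk] at h
  exact h

lemma MvPolynomial.IsHomogeneous.eq_sum_symMono3 {m : ℕ} {p : MvPolynomial (Fin 3) ℂ}
    (hp : p.IsHomogeneous m) :
    p = ∑ i : SymIdx3 m,
      MvPolynomial.C (p.coeff (symMono3 m i)) * MvPolynomial.monomial (symMono3 m i) 1 := by
  classical
  ext d
  simp only [MvPolynomial.coeff_sum, MvPolynomial.coeff_C_mul, MvPolynomial.coeff_monomial,
    mul_ite, mul_one, mul_zero]
  by_cases hd : d.degree = m
  · obtain ⟨i, rfl⟩ := exists_symMono3_eq hd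
    rw [Finset.sum_eq_single i]
    · simp
    · intro j _ hj
      rw [if_neg fun e => hj (symMono3_injective m e)]
    · simp
  · rw [hp.coeff_eq_zero hd]
    symm
    refine Finset.sum_eq_zero fun i _ => ?_
    split_ifs with e
    · subst e
      exact hp.coeff_eq_zero hd
    · rfl

lemma symMatrix3_mul (m : ℕ) (g h : Matrix (Fin 3) (Fin 3) ℂ) :
    symMatrix3 m (g * h) = symMatrix3 m g * symMatrix3 m h := by
  ext i k
  have key : symPoly3 m (g * h) k =
      ∑ j, MvPolynomial.C (symMatrix3 m h j k) * symPoly3 m g j := by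
    rw [symPoly3_eq_aeval, ← aeval_symCol3_comp, ← symPoly3_eq_aeval,
      (symPoly3_isHomogeneous m h k).eq_sum_symMono3, map_sum]
    simp [symMatrix3, symPoly3_eq_aeval m g, MvPolynomial.algebraMap_eq]
  rw [Matrix.mul_apply]
  conv_lhs => rw [symMatrix3, Matrix.of_apply, key]
  simp only [MvPolynomial.coeff_sum, MvPolynomial.coeff_C_mul]
  exact Finset.sum_congr rfl fun j _ => mul_comm _ _

lemma symMatrix3_diagonal (m : ℕ) (d : Fin 3 → ℂ) :
    symMatrix3 m (Matrix.diagonal d) = Matrix.diagonal fun k : SymIdx3 m =>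
      d 0 ^ (k.1.1 : ℕ) * d 1 ^ (k.1.2 : ℕ) * d 2 ^ (m - (k.1.1 : ℕ) - (k.1.2 : ℕ)) := by
  classical
  have hc : ∀ j, symCol3 (Matrix.diagonal d) j = MvPolynomial.C (d j) * MvPolynomial.X j := by
    intro j
    rw [symCol3, Finset.sum_eq_single j] <;> simp +contextual
  ext i k
  have hp : symPoly3 m (Matrix.diagonal d) k = MvPolynomial.C (d 0 ^ (k.1.1 : ℕ) *
      d 1 ^ (k.1.2 : ℕ) * d 2 ^ (m - (k.1.1 : ℕ) - (k.1.2 : ℕ))) *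
      MvPolynomial.monomial (symMono3 m k) 1 := by
    simp only [symPoly3, hc, symMono3, mul_pow, map_mul, map_pow]
    rw [← mul_one (1 : ℂ), ← MvPolynomial.monomial_mul, ← mul_one (1 : ℂ),
      ← MvPolynomial.monomial_mul]
    simp only [mul_one, ← MvPolynomial.X_pow_eq_monomial]
    ring
  rw [symMatrix3, Matrix.of_apply, hp, MvPolynomial.coeff_C_mul, MvPolynomial.coeff_monomial,
    Matrix.diagonal_apply]
  simp only [(symMono3_injective m).eq_iff, eq_comm (a := k)]
  split_ifs with e
  · subst e; simp
  · simp

lemma symMatrix3_one (m : ℕ) : symMatrix3 m 1 = 1 := by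
  rw [← Matrix.diagonal_one, symMatrix3_diagonal]
  simp

lemma fifth_root_facts {ζ : ℂ} (hζ : ζ = Complex.exp (2 * (Real.pi : ℂ) * Complex.I / 5)) :
    1 + ζ + ζ ^ 2 + ζ ^ 3 + ζ ^ 4 = 0 ∧ (Real.sqrt 5 : ℂ) = ζ + ζ ^ 4 - ζ ^ 2 - ζ ^ 3 := by
  have hp : IsPrimitiveRoot ζ 5 := by
    rw [hζ]
    exact_mod_cast Complex.isPrimitiveRoot_exp 5 (by norm_num)
  have h0 : 1 + ζ + ζ ^ 2 + ζ ^ 3 + ζ ^ 4 = 0 := by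
    have := hp.geom_sum_eq_zero (by norm_num)
    simpa [Finset.sum_range_succ] using this
  refine ⟨h0, ?_⟩
  have h23 : ζ ^ 2 + ζ ^ 3 = -(1 + (Real.sqrt 5 : ℂ)) / 2 := by
    have e2 : ζ ^ 2 = -Complex.exp (-((Real.pi / 5 : ℝ) : ℂ) * Complex.I) := by
      rw [hζ, ← Complex.exp_nat_mul, ← neg_one_mul, ← Complex.exp_pi_mul_I, ← Complex.exp_add]
      congr 1
      push_cast
      ring
    have e3 : ζ ^ 3 = -Complex.exp (((Real.pi / 5 : ℝ) : ℂ) * Complex.I) := by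
      rw [hζ, ← Complex.exp_nat_mul, ← neg_one_mul, ← Complex.exp_pi_mul_I, ← Complex.exp_add]
      congr 1
      push_cast
      ring
    have hc : Complex.cos ((Real.pi / 5 : ℝ) : ℂ) = (1 + (Real.sqrt 5 : ℂ)) / 4 := by
      rw [← Complex.ofReal_cos, Real.cos_pi_div_five]
      push_cast
      ring
    rw [Complex.cos] at hc
    rw [e2, e3]
    linear_combination (-2) * hc
  linear_combination 2 * h23 - h0

lemma exists_eigenbasis {g : Matrix (Fin 3) (Fin 3) ℂ} {d : Fin 3 → ℂ}
    (hd : Function.Injective d) (hg : ∀ i, (g - Matrix.scalar (Fin 3) (d i)).det = 0) :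
    ∃ P : Matrix (Fin 3) (Fin 3) ℂ, IsUnit P ∧ g * P = P * Matrix.diagonal d := by
  have hv : ∀ i, ∃ v : Fin 3 → ℂ, v ≠ 0 ∧ g *ᵥ v = d i • v := fun i => by
    obtain ⟨v, hv, h⟩ := Matrix.exists_mulVec_eq_zero_iff.mpr (hg i)
    refine ⟨v, hv, ?_⟩
    rw [Matrix.sub_mulVec, sub_eq_zero] at h
    rw [h]
    ext j
    simp [Matrix.scalar_apply, Matrix.mulVec_diagonal]
  choose v hv0 hv using hv
  refine ⟨Matrix.of fun i j => v j i, ?_, ?_⟩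
  · rw [← Matrix.linearIndependent_cols_iff_isUnit]
    exact Module.End.eigenvectors_linearIndependent' g.mulVecLin d hd v fun i =>
      ⟨Module.End.mem_eigenspace_iff.mpr (by simpa using hv i), hv0 i⟩
  · ext i j
    have := congrFun (hv j) i
    simp only [Matrix.mul_diagonal, Matrix.of_apply]
    rw [Matrix.mul_apply]
    simpa [Matrix.mulVec, dotProduct, mul_comm] using this

lemma trace_symMatrix3_eq_of_mul_eq {g h P : Matrix (Fin 3) (Fin 3) ℂ} (hP : IsUnit P)
    (hgh : g * P = P * h) (m : ℕ) :
    (symMatrix3 m g).trace = (symMatrix3 m h).trace := by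
  obtain ⟨P, rfl⟩ := hP
  have : g = P.1 * (h * P.inv) := by
    rw [← mul_assoc, ← hgh, mul_assoc, P.val_inv, mul_one]
  rw [this, symMatrix3_mul, Matrix.trace_mul_comm, ← symMatrix3_mul, mul_assoc, P.inv_val,
    mul_one]

/-- The Molien generating function `Σ tr(Symᵐ g) tᵐ`. -/
noncomputable def symTraceSeries3 (g : Matrix (Fin 3) (Fin 3) ℂ) : ℂ⟦X⟧ :=
  PowerSeries.mk fun m => (symMatrix3 m g).trace

lemma mk_pow_mul_one_sub (a : ℂ) : (PowerSeries.mk fun n => a ^ n) * (1 - C a * X) = 1 := by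
  ext n
  rw [mul_sub, mul_one, map_sub, mul_left_comm, coeff_C_mul]
  cases n with
  | zero => simp
  | succ n => simp [coeff_succ_mul_X, pow_succ', coeff_one]

lemma symTraceSeries3_diagonal (d : Fin 3 → ℂ) :
    symTraceSeries3 (Matrix.diagonal d) =
      (PowerSeries.mk fun n => d 0 ^ n) * ((PowerSeries.mk fun n => d 1 ^ n) *
        (PowerSeries.mk fun n => d 2 ^ n)) := by
  ext m
  simp only [symTraceSeries3, coeff_mk, symMatrix3_diagonal, Matrix.trace_diagonal, coeff_mul,
    Finset.mul_sum]
  rw [Finset.sum_sigma']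
  refine Finset.sum_bij'
    (i := fun k _ => ⟨(k.1.1, m - k.1.1), (k.1.2, m - k.1.1 - k.1.2)⟩)
    (j := fun p hp => ⟨(⟨p.1.1, ?_⟩, ⟨p.2.1, ?_⟩), ?_⟩) ?_ ?_ ?_ ?_ ?_
  · simp only [Finset.mem_sigma, Finset.HasAntidiagonal.mem_antidiagonal] at hp; omega
  · simp only [Finset.mem_sigma, Finset.HasAntidiagonal.mem_antidiagonal] at hp; omega
  · simp only [Finset.mem_sigma, Finset.HasAntidiagonal.mem_antidiagonal] at hp; simp only; omega
  · intro k _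
    have := k.2
    simp only [Finset.mem_sigma, Finset.HasAntidiagonal.mem_antidiagonal]
    omega
  · simp
  · simp
  · rintro ⟨⟨a, b⟩, ⟨c, e⟩⟩ hp
    simp only [Finset.mem_sigma, Finset.HasAntidiagonal.mem_antidiagonal] at hp
    obtain ⟨rfl, rfl⟩ := hp
    simp
  · intro k _
    simp [mul_assoc]

lemma symTraceSeries3_mul_of_mul_eq {g P : Matrix (Fin 3) (Fin 3) ℂ} {d : Fin 3 → ℂ}
    (hP : IsUnit P) (hg : g * P = P * Matrix.diagonal d) :
    symTraceSeries3 g * ((1 - C (d 0) * X) * (1 - C (d 1) * X) * (1 - C (d 2) * X)) = 1 := by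
  have : symTraceSeries3 g = symTraceSeries3 (Matrix.diagonal d) := by
    ext m
    simp only [symTraceSeries3, coeff_mk, trace_symMatrix3_eq_of_mul_eq hP hg m]
  rw [this, symTraceSeries3_diagonal]
  calc _ = ((PowerSeries.mk fun n => d 0 ^ n) * (1 - C (d 0) * X)) *
        ((PowerSeries.mk fun n => d 1 ^ n) * (1 - C (d 1) * X)) *
        ((PowerSeries.mk fun n => d 2 ^ n) * (1 - C (d 2) * X)) := by ring
    _ = 1 := by simp only [mk_pow_mul_one_sub, mul_one]

/-- Generators `s`, `u`, `t` satisfying the relations of the icosahedral rotation group in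
which every element is `sⁱ uᵉ` or `sⁱ t sʲ uᵉ`. -/
structure IsIcosahedralTriple {A : Type*} [Monoid A] (s u t : A) : Prop where
  s_pow_five : s ^ 5 = 1
  u_mul_u : u * u = 1
  t_mul_t : t * t = 1
  u_mul_s : u * s = s ^ 4 * u
  u_mul_t : u * t = t * u
  t_s_t : t * s * t = s ^ 4 * t * s ^ 4
  t_s2_t : t * s ^ 2 * t = s ^ 2 * t * s ^ 3 * u
  t_s3_t : t * s ^ 3 * t = s ^ 3 * t * s ^ 2 * u
  t_s4_t : t * s ^ 4 * t = s * t * s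

namespace IsIcosahedralTriple

lemma map {A B : Type*} [Monoid A] [Monoid B] {s u t : A} (h : IsIcosahedralTriple s u t)
    (f : A →* B) : IsIcosahedralTriple (f s) (f u) (f t) := by
  constructor <;> simp only [← map_mul, ← map_pow]
  · rw [h.s_pow_five, map_one]
  · rw [h.u_mul_u, map_one]
  · rw [h.t_mul_t, map_one]
  · rw [h.u_mul_s]
  · rw [h.u_mul_t]
  · rw [h.t_s_t]
  · rw [h.t_s2_t]
  · rw [h.t_s3_t]
  · rw [h.t_s4_t]

section Ring

variable {A : Type*} [Ring A]

/-- The sum of the powers of an element of order five. -/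
def cyclicSum (s : A) : A := 1 + s + s ^ 2 + s ^ 3 + s ^ 4

/-- The sum of the elements of the icosahedral rotation group. -/
def groupSum (s u t : A) : A := cyclicSum s * (1 + t * cyclicSum s) * (1 + u)

variable {s u t : A} (h : IsIcosahedralTriple s u t)

include h

lemma s_mul_cyclicSum : s * cyclicSum s = cyclicSum s := by
  have := h.s_pow_five
  calc s * cyclicSum s = s + s ^ 2 + s ^ 3 + s ^ 4 + s ^ 5 := by unfold cyclicSum; noncomm_ring
    _ = cyclicSum s := by rw [this, cyclicSum]; abel

lemma s_pow_mul_cyclicSum (n : ℕ) : s ^ n * cyclicSum s = cyclicSum s := by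
  induction n with
  | zero => simp
  | succ n ih => rw [pow_succ, mul_assoc, h.s_mul_cyclicSum, ih]

lemma cyclicSum_mul_self : cyclicSum s * cyclicSum s = 5 • cyclicSum s := by
  conv_lhs => enter [1]; rw [cyclicSum]
  simp only [add_mul, h.s_pow_mul_cyclicSum, h.s_mul_cyclicSum, one_mul]
  abel

lemma u_mul_s_pow (n : ℕ) : u * s ^ n = s ^ (4 * n) * u := by
  induction n with
  | zero => simp
  | succ n ih => rw [pow_succ, ← mul_assoc, ih, mul_assoc, h.u_mul_s, ← mul_assoc, ← pow_add,
      mul_add, mul_one]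

lemma u_mul_cyclicSum : u * cyclicSum s = cyclicSum s * u := by
  have h8 : s ^ 8 = s ^ 3 := by rw [show 8 = 5 + 3 from rfl, pow_add, h.s_pow_five, one_mul]
  have h12 : s ^ 12 = s ^ 2 := by
    rw [show 12 = 5 + 5 + 2 from rfl, pow_add, pow_add, h.s_pow_five, one_mul, one_mul]
  have h16 : s ^ 16 = s := by
    rw [show 16 = 5 + 5 + 5 + 1 from rfl, pow_add, pow_add, pow_add, h.s_pow_five, one_mul,
      one_mul, one_mul, pow_one]
  simp only [cyclicSum, mul_add, add_mul, h.u_mul_s, h.u_mul_s_pow]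
  norm_num only
  rw [h8, h12, h16]
  noncomm_ring

lemma s_mul_groupSum : s * groupSum s u t = groupSum s u t := by
  simp only [groupSum, ← mul_assoc, h.s_mul_cyclicSum]

lemma u_mul_groupSum : u * groupSum s u t = groupSum s u t := by
  have hu : u * (1 + u) = 1 + u := by rw [mul_add, mul_one, h.u_mul_u, add_comm]
  have hc : u * (1 + t * cyclicSum s) = (1 + t * cyclicSum s) * u := by
    rw [mul_add, add_mul, mul_one, one_mul, ← mul_assoc, h.u_mul_t, mul_assoc,
      h.u_mul_cyclicSum, mul_assoc]
  rw [groupSum, ← mul_assoc, ← mul_assoc, h.u_mul_cyclicSum, mul_assoc _ u, hc, mul_assoc,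
    mul_assoc _ u, hu, ← mul_assoc]

lemma t_mul_groupSum : t * groupSum s u t = groupSum s u t := by
  have hu : u * (1 + u) = 1 + u := by rw [mul_add, mul_one, h.u_mul_u, add_comm]
  have ht : t * cyclicSum s * t = 1 + s ^ 4 * t * s ^ 4 + s ^ 2 * t * s ^ 3 * u
      + s ^ 3 * t * s ^ 2 * u + s * t * s := by
    rw [← h.t_s_t, ← h.t_s2_t, ← h.t_s3_t, ← h.t_s4_t, ← h.t_mul_t, cyclicSum]
    noncomm_ring
  set V := cyclicSum s * (1 + u) with hV
  have hsV (n : ℕ) : s ^ n * V = V := by rw [hV, ← mul_assoc, h.s_pow_mul_cyclicSum]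
  have hsV1 : s * V = V := by simpa using hsV 1
  have huV : u * V = V := by rw [hV, ← mul_assoc, h.u_mul_cyclicSum, mul_assoc, hu]
  have hE : groupSum s u t = V + cyclicSum s * (t * V) := by rw [groupSum, hV]; noncomm_ring
  calc t * groupSum s u t = t * V + t * cyclicSum s * t * V := by rw [hE]; noncomm_ring
    _ = V + cyclicSum s * (t * V) := by
      rw [ht]
      simp only [add_mul, mul_assoc, hsV, hsV1, huV, one_mul, cyclicSum]
      abel
    _ = groupSum s u t := hE.symm

end Ring

section Trace

variable {n : Type*} [Fintype n] [DecidableEq n] {s u t : Matrix n n ℂ}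
  (h : IsIcosahedralTriple s u t)

include h

lemma trace_conj_u (g : Matrix n n ℂ) : (u * g * u).trace = g.trace := by
  rw [Matrix.trace_mul_comm, ← mul_assoc, h.u_mul_u, one_mul]

lemma trace_conj_s_pow (k : ℕ) (hk : k ≤ 5) (g : Matrix n n ℂ) :
    (s ^ k * g * s ^ (5 - k)).trace = g.trace := by
  rw [Matrix.trace_mul_comm, ← mul_assoc, ← pow_add, Nat.sub_add_cancel hk, h.s_pow_five,
    one_mul]

lemma trace_mul_cyclicSum {g : Matrix n n ℂ} (hg : u * g = g * u) :
    (g * cyclicSum s).trace = g.trace + 2 * (g * s).trace + 2 * (g * s ^ 2).trace := by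
  have conj (k : ℕ) : (g * s ^ (4 * k)).trace = (g * s ^ k).trace := by
    rw [← h.trace_conj_u (g * s ^ k), ← mul_assoc, hg, mul_assoc g, h.u_mul_s_pow, mul_assoc g,
      mul_assoc _ u, h.u_mul_u, mul_one]
  have h4 := conj 1
  have h3 := conj 2
  rw [show 4 * 2 = 5 + 3 from rfl, pow_add, h.s_pow_five, one_mul] at h3
  rw [pow_one] at h4
  simp only [mul_one] at h4
  simp only [cyclicSum, mul_add, mul_one, Matrix.trace_add, h3, h4]
  ring

lemma trace_cyclicSum_mul_u : (cyclicSum s * u).trace = 5 * u.trace := by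
  have conj (k : ℕ) (hk : k ≤ 5) : (s ^ (k + 4 * (5 - k)) * u).trace = u.trace := by
    rw [pow_add, mul_assoc, ← h.u_mul_s_pow, ← mul_assoc, h.trace_conj_s_pow k hk]
  have red (k q j : ℕ) (hk : k ≤ 5) (e : k + 4 * (5 - k) = 5 * q + j) :
      (s ^ j * u).trace = u.trace := by
    rw [← conj k hk, e, pow_add, pow_mul, h.s_pow_five, one_pow, one_mul]
  have h1 := red 3 2 1 (by norm_num) rfl
  rw [pow_one] at h1
  simp only [cyclicSum, add_mul, one_mul, Matrix.trace_add, h1,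
    red 1 3 2 (by norm_num) rfl, red 4 1 3 (by norm_num) rfl, red 2 2 4 (by norm_num) rfl]
  ring

lemma trace_groupSum : (groupSum s u t).trace =
    Fintype.card n + 2 * s.trace + 2 * (s ^ 2).trace + 5 * u.trace
      + 5 * (t.trace + 2 * (t * s).trace + 2 * (t * s ^ 2).trace)
      + 5 * ((t * u).trace + 2 * (t * u * s).trace + 2 * (t * u * s ^ 2).trace) := by
  have h1 := h.trace_mul_cyclicSum (g := 1) (by simp)
  simp only [one_mul, Matrix.trace_one] at h1
  have h2 := h.trace_mul_cyclicSum h.u_mul_t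
  have h3 := h.trace_mul_cyclicSum (g := t * u) (by rw [← mul_assoc, h.u_mul_t])
  have e : groupSum s u t = 1 * cyclicSum s + cyclicSum s * u
      + cyclicSum s * (t * cyclicSum s) + cyclicSum s * (t * u * cyclicSum s) := by
    rw [mul_assoc t u, h.u_mul_cyclicSum, groupSum]
    noncomm_ring
  have h5 (g : Matrix n n ℂ) : (cyclicSum s * (g * cyclicSum s)).trace =
      5 * (g * cyclicSum s).trace := by
    rw [Matrix.trace_mul_comm, mul_assoc, h.cyclicSum_mul_self, mul_smul_comm, Matrix.trace_smul,
      nsmul_eq_mul, Nat.cast_ofNat]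
  rw [e]
  simp only [Matrix.trace_add, h1, h2, h3, h5, h.trace_cyclicSum_mul_u, one_mul]

end Trace

end IsIcosahedralTriple

/-- The generator `T` of the icosahedral group, with `1/√5` expressed through `ζ`. -/
noncomputable def icosaT (ζ : ℂ) : Matrix (Fin 3) (Fin 3) ℂ :=
  ((ζ + ζ ^ 4 - ζ ^ 2 - ζ ^ 3) / 5) •
    !![1, 1, 1; 2, ζ ^ 2 + ζ ^ 3, ζ + ζ ^ 4; 2, ζ + ζ ^ 4, ζ ^ 2 + ζ ^ 3]

/-- The generator `S` of the icosahedral group. -/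
def icosaS (ζ : ℂ) : Matrix (Fin 3) (Fin 3) ℂ := !![1, 0, 0; 0, ζ ^ 4, 0; 0, 0, ζ]

/-- The generator `U` of the icosahedral group. -/
def icosaU : Matrix (Fin 3) (Fin 3) ℂ := !![-1, 0, 0; 0, 0, -1; 0, -1, 0]

lemma icosaS_eq_diagonal (ζ : ℂ) : icosaS ζ = Matrix.diagonal ![1, ζ ^ 4, ζ] := by
  ext i j; fin_cases i <;> fin_cases j <;> simp [icosaS]

section

variable {ζ : ℂ} (h0 : 1 + ζ + ζ ^ 2 + ζ ^ 3 + ζ ^ 4 = 0)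

include h0

lemma icosaT_eq : icosaT ζ = (5 : ℂ)⁻¹ •
    !![-1 - 2 * ζ ^ 2 - 2 * ζ ^ 3, -1 - 2 * ζ ^ 2 - 2 * ζ ^ 3, -1 - 2 * ζ ^ 2 - 2 * ζ ^ 3;
      -2 - 4 * ζ ^ 2 - 4 * ζ ^ 3, -2 + ζ ^ 2 + ζ ^ 3, 3 + ζ ^ 2 + ζ ^ 3;
      -2 - 4 * ζ ^ 2 - 4 * ζ ^ 3, 3 + ζ ^ 2 + ζ ^ 3, -2 + ζ ^ 2 + ζ ^ 3] := by
  ext i j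
  fin_cases i <;> fin_cases j <;> simp [icosaT] <;> grind

lemma pow_five_eq_one : ζ ^ 5 = 1 := by linear_combination (ζ - 1) * h0

lemma isIcosahedralTriple_icosa : IsIcosahedralTriple (icosaS ζ) icosaU (icosaT ζ) := by
  have h5 := pow_five_eq_one h0
  have hS (n : ℕ) : icosaS ζ ^ n = !![1, 0, 0; 0, ζ ^ (4 * n), 0; 0, 0, ζ ^ n] := by
    rw [icosaS_eq_diagonal, Matrix.diagonal_pow]
    ext i j; fin_cases i <;> fin_cases j <;> simp [pow_mul]
  constructor
  · rw [hS, mul_comm, pow_mul, h5]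
    ext i j; fin_cases i <;> fin_cases j <;> simp
  · ext i j; fin_cases i <;> fin_cases j <;> simp [icosaU, Matrix.mul_apply, Fin.sum_univ_three]
  · rw [icosaT_eq h0]
    ext i j
    fin_cases i <;> fin_cases j <;>
      simp [Matrix.mul_apply, Fin.sum_univ_three] <;> grind
  · rw [hS]
    ext i j
    fin_cases i <;> fin_cases j <;> simp [icosaS, icosaU, Matrix.mul_apply, Fin.sum_univ_three]
    grind
  · rw [icosaT_eq h0]
    ext i j
    fin_cases i <;> fin_cases j <;> simp [icosaU, Matrix.mul_apply, Fin.sum_univ_three]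
  · rw [icosaT_eq h0, hS]
    ext i j
    fin_cases i <;> fin_cases j <;>
      simp [icosaS, Matrix.mul_apply, Fin.sum_univ_three] <;> grind
  · rw [icosaT_eq h0, hS, hS]
    ext i j
    fin_cases i <;> fin_cases j <;>
      simp [icosaU, Matrix.mul_apply, Fin.sum_univ_three] <;> grind
  · rw [icosaT_eq h0, hS, hS]
    ext i j
    fin_cases i <;> fin_cases j <;>
      simp [icosaU, Matrix.mul_apply, Fin.sum_univ_three] <;> grind
  · rw [icosaT_eq h0, hS]
    ext i j
    fin_cases i <;> fin_cases j <;>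
      simp [icosaS, Matrix.mul_apply, Fin.sum_univ_three] <;> grind

end

/-- `g ↦ Symᵐ(g)` as a monoid homomorphism. -/
noncomputable def symMatrix3Hom (m : ℕ) :
    Matrix (Fin 3) (Fin 3) ℂ →* Matrix (SymIdx3 m) (SymIdx3 m) ℂ where
  toFun := symMatrix3 m
  map_one' := symMatrix3_one m
  map_mul' := symMatrix3_mul m

lemma mulVec_cyclicSum {n : Type*} [Fintype n] [DecidableEq n] {s : Matrix n n ℂ} {v : n → ℂ}
    (hs : s *ᵥ v = v) : IsIcosahedralTriple.cyclicSum s *ᵥ v = (5 : ℂ) • v := by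
  have hp (k : ℕ) : (s ^ k) *ᵥ v = v := by
    induction k with
    | zero => simp
    | succ k ih => rw [pow_succ, ← Matrix.mulVec_mulVec, hs, ih]
  simp only [IsIcosahedralTriple.cyclicSum, Matrix.add_mulVec, Matrix.one_mulVec, hs, hp]
  module

lemma mulVec_groupSum {n : Type*} [Fintype n] [DecidableEq n] {s u t : Matrix n n ℂ}
    {v : n → ℂ} (hs : s *ᵥ v = v) (hu : u *ᵥ v = v) (ht : t *ᵥ v = v) :
    IsIcosahedralTriple.groupSum s u t *ᵥ v = (60 : ℂ) • v := by
  simp only [IsIcosahedralTriple.groupSum, ← Matrix.mulVec_mulVec, Matrix.add_mulVec,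
    Matrix.one_mulVec, hu, Matrix.mulVec_add, Matrix.mulVec_smul, ht, mulVec_cyclicSum hs]
  module

lemma det_icosaU : icosaU.det = 1 := by
  simp [icosaU, Matrix.det_fin_three]

section

variable {ζ : ℂ} (h0 : 1 + ζ + ζ ^ 2 + ζ ^ 3 + ζ ^ 4 = 0)

include h0

lemma det_icosaT : (icosaT ζ).det = 1 := by
  rw [icosaT_eq h0, Matrix.det_fin_three]
  simp
  grind

lemma det_icosaS : (icosaS ζ).det = 1 := by
  rw [icosaS_eq_diagonal, Matrix.det_diagonal, Fin.prod_univ_three]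
  simpa [pow_succ] using pow_five_eq_one h0

lemma finrank_symInvariants3_icosa {Γ : Subgroup (SpecialLinearGroup (Fin 3) ℂ)}
    (hΓ : Γ = Subgroup.closure {g : SpecialLinearGroup (Fin 3) ℂ |
      (g : Matrix (Fin 3) (Fin 3) ℂ) = icosaS ζ ∨ (g : Matrix (Fin 3) (Fin 3) ℂ) = icosaU ∨
        (g : Matrix (Fin 3) (Fin 3) ℂ) = icosaT ζ}) (m : ℕ) :
    60 * (Module.finrank ℂ (symInvariants3 Γ m) : ℂ) =
      (IsIcosahedralTriple.groupSum (symMatrix3 m (icosaS ζ)) (symMatrix3 m icosaU)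
        (symMatrix3 m (icosaT ζ))).trace := by
  have h : IsIcosahedralTriple (symMatrix3 m (icosaS ζ)) (symMatrix3 m icosaU)
      (symMatrix3 m (icosaT ζ)) := (isIcosahedralTriple_icosa h0).map (symMatrix3Hom m)
  set E := IsIcosahedralTriple.groupSum (symMatrix3 m (icosaS ζ)) (symMatrix3 m icosaU)
    (symMatrix3 m (icosaT ζ)) with hE
  have hinv : ∀ g ∈ Γ, symMatrix3 m (g : Matrix (Fin 3) (Fin 3) ℂ) * E = E := by
    intro g hg
    rw [hΓ] at hg
    induction hg using Subgroup.closure_induction with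
    | mem g hg =>
      obtain hg | hg | hg := hg <;> rw [hg]
      exacts [h.s_mul_groupSum, h.u_mul_groupSum, h.t_mul_groupSum]
    | one =>
      change symMatrix3 m 1 * E = E
      rw [symMatrix3_one, one_mul]
    | mul x y _ _ hx hy =>
      change symMatrix3 m (x.1 * y.1) * E = E
      rw [symMatrix3_mul, mul_assoc, hy, hx]
    | inv x _ hx =>
      have hxx : (x⁻¹).1 * x.1 = 1 := congrArg Subtype.val (inv_mul_cancel x)
      change symMatrix3 m (x⁻¹).1 * E = E
      conv_lhs => rw [← hx]
      rw [← mul_assoc, ← symMatrix3_mul, hxx, symMatrix3_one, one_mul]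
  have hmem {g : Matrix (Fin 3) (Fin 3) ℂ} (hd : g.det = 1)
      (hg : g = icosaS ζ ∨ g = icosaU ∨ g = icosaT ζ) {v : SymIdx3 m → ℂ}
      (hv : v ∈ symInvariants3 Γ m) : symMatrix3 m g *ᵥ v = v :=
    hv ⟨g, hd⟩ (hΓ ▸ Subgroup.subset_closure hg)
  have hproj : LinearMap.IsProj (symInvariants3 Γ m) (Matrix.toLin' ((60 : ℂ)⁻¹ • E)) := by
    constructor
    · intro v g hg
      rw [Matrix.toLin'_apply, Matrix.mulVec_mulVec, mul_smul_comm, hinv g hg]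
    · intro v hv
      rw [Matrix.toLin'_apply, Matrix.smul_mulVec, hE,
        mulVec_groupSum (hmem (det_icosaS h0) (Or.inl rfl) hv)
          (hmem det_icosaU (Or.inr (Or.inl rfl)) hv)
          (hmem (det_icosaT h0) (Or.inr (Or.inr rfl)) hv), smul_smul]
      norm_num
  rw [← hproj.trace, Matrix.trace_toLin'_eq, Matrix.trace_smul, smul_eq_mul]
  ring

end

lemma symTraceSeries3_mul_of_det {g : Matrix (Fin 3) (Fin 3) ℂ} {a b c : ℂ}
    (hd : Function.Injective ![a, b, c]) (ha : (g - Matrix.scalar (Fin 3) a).det = 0)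
    (hb : (g - Matrix.scalar (Fin 3) b).det = 0) (hc : (g - Matrix.scalar (Fin 3) c).det = 0) :
    symTraceSeries3 g * ((1 - C a * X) * (1 - C b * X) * (1 - C c * X)) = 1 := by
  obtain ⟨d, hd, rfl, rfl, rfl⟩ :
      ∃ d : Fin 3 → ℂ, Function.Injective d ∧ d 0 = a ∧ d 1 = b ∧ d 2 = c :=
    ⟨![a, b, c], hd, rfl, rfl, rfl⟩
  obtain ⟨P, hP, h⟩ := exists_eigenbasis hd (Fin.forall_fin_succ.mpr
    ⟨ha, Fin.forall_fin_two.mpr ⟨hb, hc⟩⟩)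
  exact symTraceSeries3_mul_of_mul_eq hP h

lemma symTraceSeries3_diagonal_mul (a b c : ℂ) :
    symTraceSeries3 (Matrix.diagonal ![a, b, c]) *
      ((1 - C a * X) * (1 - C b * X) * (1 - C c * X)) = 1 :=
  symTraceSeries3_mul_of_mul_eq (d := ![a, b, c]) isUnit_one (by rw [mul_one, one_mul])

lemma symTraceSeries3_one_mul : symTraceSeries3 1 * (1 - X) ^ 3 = 1 := by
  have h := symTraceSeries3_mul_of_mul_eq (g := 1) (d := fun _ => 1) isUnit_one (by simp)
  refine Eq.trans (congrArg _ ?_) h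
  simp only [map_one]
  ring

lemma one_sub_mul_of_cube_root {ω : ℂ} (hω : 1 + ω + ω ^ 2 = 0) :
    (1 - C (1 : ℂ) * X) * (1 - C ω * X) * (1 - C (ω ^ 2) * X) = 1 - X ^ 3 := by
  have hC : 1 + C ω + C ω ^ 2 = (0 : ℂ⟦X⟧) := by
    rw [← map_pow, ← map_one C, ← map_add, ← map_add, hω, map_zero]
  simp only [map_one, map_pow]
  linear_combination (-X + X ^ 2 + (C ω - 1) * X ^ 2 * (1 - X)) * hC

lemma one_sub_mul_of_mul_eq_one {a b : ℂ} (hab : a * b = 1) :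
    (1 - C (1 : ℂ) * X) * (1 - C a * X) * (1 - C b * X) =
      (1 - X) * (1 - C (a + b) * X + X ^ 2) := by
  have hC : C a * C b = (1 : ℂ⟦X⟧) := by rw [← map_mul, hab, map_one]
  simp only [map_one, map_add]
  linear_combination (1 - X) * X ^ 2 * hC

lemma symTraceSeries3_icosaU_mul : symTraceSeries3 icosaU * ((1 - X) * (1 + X) ^ 2) = 1 := by
  have h := symTraceSeries3_mul_of_mul_eq (g := icosaU) (P := !![1, 0, 0; 0, 1, 1; 0, 1, -1])
    (d := ![-1, -1, 1]) ?_ ?_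
  · refine Eq.trans (congrArg _ ?_) h
    simp
    ring
  · rw [Matrix.isUnit_iff_isUnit_det, isUnit_iff_ne_zero, Matrix.det_fin_three]
    simp
    norm_num
  · ext i j
    fin_cases i <;> fin_cases j <;> simp [icosaU, Matrix.mul_apply, Fin.sum_univ_three]

lemma injective_cube_roots {ω : ℂ} (hω : 1 + ω + ω ^ 2 = 0) :
    Function.Injective ![1, ω, ω ^ 2] := by
  intro i j
  fin_cases i <;> fin_cases j <;> simp <;> grind

/-- Eigenvectors of the commuting involutions `T` and `T U`. -/
def involutionBasis (ζ : ℂ) : Matrix (Fin 3) (Fin 3) ℂ :=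
  !![0, 2, 2; 1, -2 - 2 * ζ ^ 2 - 2 * ζ ^ 3, 2 * ζ ^ 2 + 2 * ζ ^ 3;
    -1, -2 - 2 * ζ ^ 2 - 2 * ζ ^ 3, 2 * ζ ^ 2 + 2 * ζ ^ 3]

section

variable {ζ : ℂ} (h0 : 1 + ζ + ζ ^ 2 + ζ ^ 3 + ζ ^ 4 = 0)

include h0

lemma injective_fifth_roots : Function.Injective ![1, ζ, ζ ^ 4] := by
  have h5 := pow_five_eq_one h0
  intro i j
  fin_cases i <;> fin_cases j <;> simp <;> grind

lemma isUnit_involutionBasis : IsUnit (involutionBasis ζ) := by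
  rw [Matrix.isUnit_iff_isUnit_det, isUnit_iff_ne_zero, Matrix.det_fin_three]
  simp [involutionBasis]
  grind

lemma symTraceSeries3_icosaT_mul :
    symTraceSeries3 (icosaT ζ) * ((1 - X) * (1 + X) ^ 2) = 1 := by
  have h := symTraceSeries3_mul_of_mul_eq (g := icosaT ζ) (d := ![-1, 1, -1])
    (isUnit_involutionBasis h0) ?_
  · refine Eq.trans (congrArg _ ?_) h
    simp
    ring
  · rw [icosaT_eq h0]
    ext i j
    fin_cases i <;> fin_cases j <;>
      simp [involutionBasis, Matrix.mul_apply, Fin.sum_univ_three] <;> grind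

lemma symTraceSeries3_icosaT_mul_icosaU_mul :
    symTraceSeries3 (icosaT ζ * icosaU) * ((1 - X) * (1 + X) ^ 2) = 1 := by
  have h := symTraceSeries3_mul_of_mul_eq (g := icosaT ζ * icosaU) (d := ![-1, -1, 1])
    (isUnit_involutionBasis h0) ?_
  · refine Eq.trans (congrArg _ ?_) h
    simp
    ring
  · rw [icosaT_eq h0]
    ext i j
    fin_cases i <;> fin_cases j <;>
      simp [involutionBasis, icosaU, Matrix.mul_apply, Fin.sum_univ_three] <;> grind

lemma symTraceSeries3_icosaT_mul_icosaS_mul {ω : ℂ} (hω : 1 + ω + ω ^ 2 = 0) :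
    symTraceSeries3 (icosaT ζ * icosaS ζ) * (1 - X ^ 3) = 1 := by
  rw [← one_sub_mul_of_cube_root hω]
  refine symTraceSeries3_mul_of_det (injective_cube_roots hω) ?_ ?_ ?_ <;>
  rw [icosaT_eq h0, Matrix.det_fin_three] <;>
  simp [icosaS] <;> grind

lemma symTraceSeries3_icosaT_mul_icosaU_mul_icosaS_sq_mul {ω : ℂ} (hω : 1 + ω + ω ^ 2 = 0) :
    symTraceSeries3 (icosaT ζ * icosaU * icosaS ζ ^ 2) * (1 - X ^ 3) = 1 := by
  rw [← one_sub_mul_of_cube_root hω]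
  refine symTraceSeries3_mul_of_det (injective_cube_roots hω) ?_ ?_ ?_ <;>
  rw [icosaT_eq h0, Matrix.det_fin_three, pow_two (icosaS ζ)] <;>
  simp [icosaS, icosaU] <;> grind

lemma symTraceSeries3_icosaS_mul :
    symTraceSeries3 (icosaS ζ) * ((1 - X) * (1 - C (ζ ^ 4 + ζ) * X + X ^ 2)) = 1 := by
  rw [icosaS_eq_diagonal, ← one_sub_mul_of_mul_eq_one (by rw [← pow_succ, pow_five_eq_one h0])]
  exact symTraceSeries3_diagonal_mul _ _ _

lemma symTraceSeries3_icosaS_sq_mul :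
    symTraceSeries3 (icosaS ζ ^ 2) * ((1 - X) * (1 - C (ζ ^ 3 + ζ ^ 2) * X + X ^ 2)) = 1 := by
  have h5 := pow_five_eq_one h0
  have hS : icosaS ζ ^ 2 = Matrix.diagonal ![1, ζ ^ 3, ζ ^ 2] := by
    rw [icosaS_eq_diagonal, Matrix.diagonal_pow]
    congr 1
    ext i
    fin_cases i <;> simp
    linear_combination ζ ^ 3 * h5
  rw [hS, ← one_sub_mul_of_mul_eq_one (by rw [← pow_add, h5])]
  exact symTraceSeries3_diagonal_mul _ _ _

lemma symTraceSeries3_icosaT_mul_icosaS_sq_mul :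
    symTraceSeries3 (icosaT ζ * icosaS ζ ^ 2) *
      ((1 - X) * (1 - C (ζ + ζ ^ 4) * X + X ^ 2)) = 1 := by
  rw [← one_sub_mul_of_mul_eq_one (by rw [← pow_succ', pow_five_eq_one h0])]
  refine symTraceSeries3_mul_of_det (injective_fifth_roots h0) ?_ ?_ ?_ <;>
  rw [icosaT_eq h0, Matrix.det_fin_three, pow_two (icosaS ζ)] <;>
  simp [icosaS] <;> grind

lemma symTraceSeries3_icosaT_mul_icosaU_mul_icosaS_mul :
    symTraceSeries3 (icosaT ζ * icosaU * icosaS ζ) *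
      ((1 - X) * (1 - C (ζ ^ 2 + ζ ^ 3) * X + X ^ 2)) = 1 := by
  rw [← one_sub_mul_of_mul_eq_one (by rw [← pow_add, pow_five_eq_one h0])]
  have hinj : Function.Injective ![1, ζ ^ 2, ζ ^ 3] := by
    have h5 := pow_five_eq_one h0
    intro i j
    fin_cases i <;> fin_cases j <;> simp <;> grind
  refine symTraceSeries3_mul_of_det hinj ?_ ?_ ?_ <;>
  rw [icosaT_eq h0, Matrix.det_fin_three] <;>
  simp [icosaS, icosaU] <;> grind

end

lemma symTraceSeries3_icosa_sum {ζ : ℂ} (h0 : 1 + ζ + ζ ^ 2 + ζ ^ 3 + ζ ^ 4 = 0)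
    {Γ : Subgroup (SpecialLinearGroup (Fin 3) ℂ)}
    (hΓ : Γ = Subgroup.closure {g : SpecialLinearGroup (Fin 3) ℂ |
      (g : Matrix (Fin 3) (Fin 3) ℂ) = icosaS ζ ∨ (g : Matrix (Fin 3) (Fin 3) ℂ) = icosaU ∨
        (g : Matrix (Fin 3) (Fin 3) ℂ) = icosaT ζ}) :
    60 * PowerSeries.mk (fun m => (Module.finrank ℂ (symInvariants3 Γ m) : ℂ)) =
      symTraceSeries3 1 + 2 * symTraceSeries3 (icosaS ζ) + 2 * symTraceSeries3 (icosaS ζ ^ 2)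
        + 5 * symTraceSeries3 icosaU
        + 5 * (symTraceSeries3 (icosaT ζ) + 2 * symTraceSeries3 (icosaT ζ * icosaS ζ)
          + 2 * symTraceSeries3 (icosaT ζ * icosaS ζ ^ 2))
        + 5 * (symTraceSeries3 (icosaT ζ * icosaU)
          + 2 * symTraceSeries3 (icosaT ζ * icosaU * icosaS ζ)
          + 2 * symTraceSeries3 (icosaT ζ * icosaU * icosaS ζ ^ 2)) := by
  ext m
  have h : IsIcosahedralTriple (symMatrix3 m (icosaS ζ)) (symMatrix3 m icosaU)
      (symMatrix3 m (icosaT ζ)) := (isIcosahedralTriple_icosa h0).map (symMatrix3Hom m)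
  have hn (k : ℕ) (f : ℂ⟦X⟧) : coeff m ((k : ℂ⟦X⟧) * f) = k * coeff m f := by
    rw [← nsmul_eq_mul, map_nsmul, nsmul_eq_mul]
  have h60 := hn 60
  have h2 := hn 2
  have h5 := hn 5
  simp only [Nat.cast_ofNat] at h60 h2 h5
  have ht := finrank_symInvariants3_icosa h0 hΓ m
  rw [h.trace_groupSum] at ht
  simp only [map_add, h60, h2, h5, symTraceSeries3, coeff_mk]
  simp only [pow_two (icosaS ζ), symMatrix3_mul, symMatrix3_one, Matrix.trace_one]
  simpa only [pow_two (symMatrix3 m (icosaS ζ))] using ht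

/-- Summing the reciprocals of the `det (1 - X g)` over the icosahedral rotation group. -/
lemma molien_icosa {R : Type*} [CommRing R] {x a b F g₁ g₂ g₃ g₅ g₅' : R}
    (hab : a + b = -1) (hm : a * b = -1)
    (h₁ : g₁ * (1 - x) ^ 3 = 1) (h₂ : g₂ * ((1 - x) * (1 + x) ^ 2) = 1)
    (h₃ : g₃ * (1 - x ^ 3) = 1) (h₅ : g₅ * ((1 - x) * (1 - a * x + x ^ 2)) = 1)
    (h₅' : g₅' * ((1 - x) * (1 - b * x + x ^ 2)) = 1)
    (hF : 60 * F = g₁ + 15 * g₂ + 20 * g₃ + 12 * g₅ + 12 * g₅') :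
    60 * ((x - 1) ^ 3 * (x ^ 2 + x + 1) * (x ^ 4 + x ^ 3 + x ^ 2 + x + 1) * (x + 1) ^ 2 * F) =
      60 * (-x ^ 8 - x ^ 7 + x ^ 5 + x ^ 4 + x ^ 3 - x - 1) := by
  have hq : x ^ 4 + x ^ 3 + x ^ 2 + x + 1 = (1 - a * x + x ^ 2) * (1 - b * x + x ^ 2) := by
    linear_combination (x + x ^ 3) * hab - x ^ 2 * hm
  have e₁ : (x - 1) ^ 3 * g₁ = -1 := by linear_combination -h₁
  have e₂ : (x - 1) ^ 3 * (x + 1) ^ 2 * g₂ = -(1 - x) ^ 2 := by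
    linear_combination -(1 - x) ^ 2 * h₂
  have e₃ : (x - 1) ^ 3 * (x ^ 2 + x + 1) * g₃ = -(1 - x) ^ 2 := by
    linear_combination -(1 - x) ^ 2 * h₃
  have e₅ : (x - 1) ^ 3 * (x ^ 4 + x ^ 3 + x ^ 2 + x + 1) * g₅ =
      -(1 - x) ^ 2 * (1 - b * x + x ^ 2) := by
    rw [hq]
    linear_combination -(1 - x) ^ 2 * (1 - b * x + x ^ 2) * h₅
  have e₅' : (x - 1) ^ 3 * (x ^ 4 + x ^ 3 + x ^ 2 + x + 1) * g₅' =
      -(1 - x) ^ 2 * (1 - a * x + x ^ 2) := by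
    rw [hq]
    linear_combination -(1 - x) ^ 2 * (1 - a * x + x ^ 2) * h₅'
  linear_combination
    (x - 1) ^ 3 * (x ^ 2 + x + 1) * (x ^ 4 + x ^ 3 + x ^ 2 + x + 1) * (x + 1) ^ 2 * hF
    + (x ^ 2 + x + 1) * (x ^ 4 + x ^ 3 + x ^ 2 + x + 1) * (x + 1) ^ 2 * e₁
    + 15 * (x ^ 2 + x + 1) * (x ^ 4 + x ^ 3 + x ^ 2 + x + 1) * e₂
    + 20 * (x ^ 4 + x ^ 3 + x ^ 2 + x + 1) * (x + 1) ^ 2 * e₃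
    + 12 * (x ^ 2 + x + 1) * (x + 1) ^ 2 * (e₅ + e₅')
    + 12 * (x ^ 2 + x + 1) * (x + 1) ^ 2 * (1 - x) ^ 2 * x * hab

/-- Type `H` (the exceptional subgroup `Γ = ⟨S, U, T⟩` of `SL₃(ℂ)` isomorphic to `A₅`):
`(t−1)³(t²+t+1)(t⁴+t³+t²+t+1)(t+1)² · Σₘ dim (Symᵐ(ℂ³))^Γ · tᵐ
  = −t⁸ − t⁷ + t⁵ + t⁴ + t³ − t − 1` in `ℂ⟦t⟧`. -/
theorem typeH_invariant_series
    (ζ : ℂ) (hζ : ζ = Complex.exp (2 * (Real.pi : ℂ) * Complex.I / 5))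
    (S U T : Matrix (Fin 3) (Fin 3) ℂ)
    (hS : S = !![1, 0, 0; 0, ζ ^ 4, 0; 0, 0, ζ])
    (hU : U = !![-1, 0, 0; 0, 0, -1; 0, -1, 0])
    (hT : T = ((Real.sqrt 5 : ℂ))⁻¹ •
      !![1, 1, 1; 2, ζ ^ 2 + ζ ^ 3, ζ + ζ ^ 4; 2, ζ + ζ ^ 4, ζ ^ 2 + ζ ^ 3])
    (Γ : Subgroup (SpecialLinearGroup (Fin 3) ℂ))
    (hΓ : Γ = Subgroup.closure {g : SpecialLinearGroup (Fin 3) ℂ |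
      (g : Matrix (Fin 3) (Fin 3) ℂ) = S ∨ (g : Matrix (Fin 3) (Fin 3) ℂ) = U ∨
        (g : Matrix (Fin 3) (Fin 3) ℂ) = T}) :
    (PowerSeries.X - 1) ^ 3 * (PowerSeries.X ^ 2 + PowerSeries.X + 1) *
        (PowerSeries.X ^ 4 + PowerSeries.X ^ 3 + PowerSeries.X ^ 2 + PowerSeries.X + 1) *
        (PowerSeries.X + 1) ^ 2 *
        PowerSeries.mk (fun m => (Module.finrank ℂ (symInvariants3 Γ m) : ℂ)) =
      -PowerSeries.X ^ 8 - PowerSeries.X ^ 7 + PowerSeries.X ^ 5 + PowerSeries.X ^ 4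
        + PowerSeries.X ^ 3 - PowerSeries.X - 1 := by
  obtain ⟨h0, h5⟩ := fifth_root_facts hζ
  have hS' : S = icosaS ζ := hS
  have hU' : U = icosaU := hU
  have hr : ((Real.sqrt 5 : ℂ))⁻¹ = (ζ + ζ ^ 4 - ζ ^ 2 - ζ ^ 3) / 5 := by
    have hsq : (Real.sqrt 5 : ℂ) * (Real.sqrt 5 : ℂ) = 5 := by
      exact_mod_cast congrArg Complex.ofReal (Real.mul_self_sqrt (show (0 : ℝ) ≤ 5 by norm_num))
    rw [← h5]
    apply inv_eq_of_mul_eq_one_right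
    linear_combination hsq / 5
  have hT' : T = icosaT ζ := by rw [hT, hr, icosaT]
  subst hS' hU' hT'
  obtain ⟨ω, hω⟩ : ∃ ω : ℂ, 1 + ω + ω ^ 2 = 0 := by
    refine ⟨Complex.exp (2 * Real.pi * Complex.I / 3), ?_⟩
    have := (Complex.isPrimitiveRoot_exp 3 (by norm_num)).geom_sum_eq_zero (by norm_num)
    simpa [Finset.sum_range_succ] using this
  have uniq {q f g : ℂ⟦X⟧} (hf : f * q = 1) (hg : g * q = 1) : f = g :=
    left_inv_eq_right_inv hf (by rw [mul_comm, hg])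
  have hF := symTraceSeries3_icosa_sum h0 hΓ
  have k₂ := symTraceSeries3_icosaU_mul
  have k₃ := symTraceSeries3_icosaT_mul_icosaS_mul h0 hω
  have k₅ := symTraceSeries3_icosaT_mul_icosaS_sq_mul h0
  have k₅' := symTraceSeries3_icosaT_mul_icosaU_mul_icosaS_mul h0
  rw [uniq (symTraceSeries3_icosaT_mul h0) k₂,
    uniq (symTraceSeries3_icosaT_mul_icosaU_mul h0) k₂,
    uniq (symTraceSeries3_icosaT_mul_icosaU_mul_icosaS_sq_mul h0 hω) k₃,
    uniq (symTraceSeries3_icosaS_mul h0) (by rw [add_comm (ζ ^ 4), k₅]),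
    uniq (symTraceSeries3_icosaS_sq_mul h0) (by rw [add_comm (ζ ^ 3), k₅'])] at hF
  have hab : C (ζ + ζ ^ 4) + C (ζ ^ 2 + ζ ^ 3) = (-1 : ℂ⟦X⟧) := by
    rw [← map_add, show ζ + ζ ^ 4 + (ζ ^ 2 + ζ ^ 3) = -1 by linear_combination h0, map_neg,
      map_one]
  have hm : C (ζ + ζ ^ 4) * C (ζ ^ 2 + ζ ^ 3) = (-1 : ℂ⟦X⟧) := by
    rw [← map_mul, show (ζ + ζ ^ 4) * (ζ ^ 2 + ζ ^ 3) = -1 by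
      linear_combination (ζ ^ 3 - ζ + 1) * h0, map_neg, map_one]
  have h60 : (60 : ℂ⟦X⟧) ≠ 0 := by
    intro h
    have h' := congrArg (PowerSeries.constantCoeff (R := ℂ)) h
    rw [map_zero, map_ofNat] at h'
    norm_num at h'
  exact mul_left_cancel₀ h60 (molien_icosa hab hm symTraceSeries3_one_mul k₂ k₃ k₅ k₅'
    (by linear_combination hF))
end
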